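/- arXiv:1203.1911 — 3 statements merged into one kernel-verified Lean document; each statement's English description precedes it below -/
import Mathlib

section
/- For each prime power q, each integer m ≥ 2, and each real number ε > 0, there is an integer R (depending on m, q, ε) such that for all n > R: ex_q(AG(m-1,q); n) < ε·(q^n-1)/(q-1). -/
/-- Containment of geometries: `H`, a set of points of `PG(m-1,q)`, is contained in a set
`M` of points of `PG(n-1,q)` if some injective linear map `F^m → F^n` maps `H` into `M`. -/
def PGContains (F : Type) [Field F] (m n : ℕ)
    (H : Set (Projectivization F (Fin m → F)))
    (M : Set (Projectivization F (Fin n → F))) : Prop :=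
  ∃ (f : (Fin m → F) →ₗ[F] (Fin n → F)) (hf : Function.Injective f),
    ∀ x ∈ H, Projectivization.map f hf x ∈ M

/-- The rank of a set of points: the dimension of its linear span. -/
noncomputable def pgRank (F : Type) [Field F] (n : ℕ)
    (G : Set (Projectivization F (Fin n → F))) : ℕ :=
  Module.finrank F ↥(⨆ x ∈ G, x.submodule)

/-- The flat determined by a subspace `W`: all projective points lying in `W`. -/
def pgFlat (F : Type) [Field F] (n : ℕ) (W : Submodule F (Fin n → F)) :
    Set (Projectivization F (Fin n → F)) :=
  {x | x.submodule ≤ W}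

/-- The standard rank-`k` subspace of `F^m`: vectors vanishing on coordinates `≥ k`. -/
def stdSubspace (F : Type) [Field F] (m k : ℕ) : Submodule F (Fin m → F) :=
  LinearMap.ker (LinearMap.funLeft F F (fun i : {i : Fin m // k ≤ (i : ℕ)} => (i : Fin m)))

/-- `G(m-1,q,c)`: the points of `PG(m-1,q)` outside a rank-`(m-c)` flat. -/
def pgDel (F : Type) [Field F] (m c : ℕ) : Set (Projectivization F (Fin m → F)) :=
  {x | ¬ x.submodule ≤ stdSubspace F m (m - c)}

/-- `ex_q(H; n)`: the maximum size of a set of points of `PG(n-1,q)` not containing `H`. -/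
noncomputable def pgEx (F : Type) [Field F] (m : ℕ)
    (H : Set (Projectivization F (Fin m → F))) (n : ℕ) : ℕ :=
  sSup {k | ∃ M : Set (Projectivization F (Fin n → F)),
    ¬ PGContains F m n H M ∧ M.ncard = k}

/-- The critical exponent of a geometry `H`: the least `c` such that `H` is contained in
`G(r-1,q,c)`, where `r` is the rank of `H`. -/
noncomputable def critExp (F : Type) [Field F] (m : ℕ)
    (H : Set (Projectivization F (Fin m → F))) : ℕ :=
  sInf {c | PGContains F m (pgRank F m H) H (pgDel F (pgRank F m H) c)}

namespace DensityHalesJewett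

/-- The combinatorial subspace described by the template `e`: coordinates with `e i = inl a` are
frozen to `a`, coordinates with `e i = inr j` copy the `j`-th parameter. -/
def app {A ι η : Type} (e : ι → A ⊕ η) (x : η → A) : ι → A := fun i => Sum.elim id x (e i)

/-- Every parameter of the template occurs. -/
def Proper {A ι η : Type} (e : ι → A ⊕ η) : Prop := ∀ j, ∃ i, e i = Sum.inr j

/-- Composition of templates. -/
def comp {A ι η ζ : Type} (e : ι → A ⊕ η) (f : η → A ⊕ ζ) : ι → A ⊕ ζ :=
  fun i => Sum.elim Sum.inl f (e i)

/-- A template over `β` seen as a template over `Option β`. -/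
def lift {β ι η : Type} (e : ι → β ⊕ η) : ι → Option β ⊕ η := fun i => Sum.map some id (e i)

theorem app_comp {A ι η ζ : Type} (e : ι → A ⊕ η) (f : η → A ⊕ ζ) (x : ζ → A) :
    app (comp e f) x = app e (app f x) := by
  funext i
  simp only [app, comp]
  cases e i <;> rfl

theorem lift_comp {β ι η ζ : Type} (e : ι → β ⊕ η) (f : η → β ⊕ ζ) :
    lift (comp e f) = comp (lift e) (lift f) := by
  funext i
  simp only [lift, comp]
  cases e i <;> rfl

theorem Proper.comp {A ι η ζ : Type} {e : ι → A ⊕ η} {f : η → A ⊕ ζ} (he : Proper e)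
    (hf : Proper f) : Proper (comp e f) := by
  intro j
  obtain ⟨k, hk⟩ := hf j
  obtain ⟨i, hi⟩ := he k
  exact ⟨i, by simp [DensityHalesJewett.comp, hi, hk]⟩

theorem Proper.lift {β ι η : Type} {e : ι → β ⊕ η} (he : Proper e) : Proper (lift e) := by
  intro j
  obtain ⟨i, hi⟩ := he j
  exact ⟨i, by simp [DensityHalesJewett.lift, hi]⟩

theorem Proper.app_injective {A ι η : Type} {e : ι → A ⊕ η} (he : Proper e) :
    Function.Injective (app e) := by
  intro x y h
  funext j
  obtain ⟨i, hi⟩ := he j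
  simpa [app, hi] using congrFun h i

/-! ### The Graham–Rothschild theorem for variable words

A word over `Option β` in which `none` occurs is a variable word over `β`. -/

/-- The colour of a variable word is determined by its prefix up to the first `none`. -/
def PrefixDetermined {β K : Type} {n : ℕ} (c : (Fin n → Option β) → K) : Prop :=
  ∀ x x' i, x i = none → x' i = none → (∀ j < i, x j = x' j) → c x = c x'

/-- The colour of a variable word is determined by the position of its first `none`. -/
def PositionDetermined {β K : Type} {n : ℕ} (c : (Fin n → Option β) → K) : Prop :=
  ∀ x x' i, x i = none → x' i = none → (∀ j < i, x j ≠ none ∧ x' j ≠ none) → c x = c x'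

theorem exists_prefixDetermined (β : Type) [Finite β] (s : ℕ) :
    ∀ (K : Type) [Finite K], ∃ n : ℕ, ∀ c : (Fin n → Option β) → K,
      ∃ e : Fin n → β ⊕ Fin s, Proper e ∧ PrefixDetermined fun x => c (app (lift e) x) := by
  induction s with
  | zero =>
    intro K _
    exact ⟨0, fun c => ⟨Fin.elim0, fun j => j.elim0, fun x x' i => i.elim0⟩⟩
  | succ s ih =>
    intro K _
    obtain ⟨n₁, h₁⟩ := ih (β → K)
    obtain ⟨n₂, h₂⟩ :=
      Combinatorics.Subspace.exists_mono_in_high_dimension_fin (Option β) K (Fin n₁)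
    refine ⟨n₂ + 1, fun c => ?_⟩
    obtain ⟨l, κ, hl⟩ := h₂ fun u => c (Fin.cons none u)
    let e₁ : Fin (n₂ + 1) → β ⊕ Fin (n₁ + 1) := Fin.cons (Sum.inr 0) fun i =>
      Sum.elim (fun a => a.elim (Sum.inr 0) Sum.inl) (fun j => Sum.inr j.succ) (l.idxFun i)
    have he₁ : Proper e₁ := by
      intro j
      refine Fin.cases ⟨0, rfl⟩ (fun j => ?_) j
      obtain ⟨i, hi⟩ := l.proper j
      exact ⟨i.succ, by simp [e₁, hi]⟩
    have h_none : ∀ u, app (lift e₁) (Fin.cons none u) = Fin.cons none (l u) := by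
      intro u
      funext i
      refine Fin.cases rfl (fun i => ?_) i
      simp only [app, lift, e₁, Fin.cons_succ, Combinatorics.Subspace.coe_apply]
      rcases l.idxFun i with (_ | b) | j <;> simp
    obtain ⟨e₂, he₂, hd⟩ := h₁ fun u b => c (app (lift e₁) (Fin.cons (some b) u))
    let e₃ : Fin (n₁ + 1) → β ⊕ Fin (s + 1) :=
      Fin.cons (Sum.inr 0) fun i => Sum.map id Fin.succ (e₂ i)
    have he₃ : Proper e₃ := by
      intro j
      refine Fin.cases ⟨0, rfl⟩ (fun j => ?_) j
      obtain ⟨i, hi⟩ := he₂ j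
      exact ⟨i.succ, by simp [e₃, hi]⟩
    have h_cons : ∀ x, app (lift e₃) x = Fin.cons (x 0) (app (lift e₂) (Fin.tail x)) := by
      intro x
      funext i
      refine Fin.cases rfl (fun i => ?_) i
      simp only [app, lift, e₃, Fin.cons_succ]
      rcases e₂ i with b | j <;> simp [Fin.tail]
    refine ⟨comp e₁ e₃, he₁.comp he₃, ?_⟩
    intro x x' i hx hx' hlt
    simp only [lift_comp, app_comp, h_cons]
    by_cases h0 : x 0 = none
    · have h0' : x' 0 = none := by
        by_cases hi : i = 0
        · rwa [hi] at hx'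
        · rw [← hlt 0 (Fin.pos_iff_ne_zero.2 hi), h0]
      rw [h0, h0', h_none, h_none]
      exact (hl _).trans (hl _).symm
    · obtain ⟨b, hb⟩ := Option.ne_none_iff_exists'.1 h0
      obtain ⟨j, rfl⟩ := Fin.exists_succ_eq.2 (show i ≠ 0 by rintro rfl; exact h0 hx)
      have hb' : x' 0 = some b := by rw [← hlt 0 (Fin.succ_pos j), hb]
      rw [hb, hb']
      exact congrFun (hd (Fin.tail x) (Fin.tail x') j hx hx' fun k hk =>
        hlt k.succ (Fin.succ_lt_succ_iff.2 hk)) b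

theorem exists_positionDetermined (β : Type) [Finite β] [Nonempty β] (K : Type) [Finite K]
    (s : ℕ) : ∃ n : ℕ, ∀ c : (Fin n → Option β) → K, PrefixDetermined c →
      ∃ e : Fin n → β ⊕ Fin s, Proper e ∧ PositionDetermined fun x => c (app (lift e) x) := by
  induction s with
  | zero => exact ⟨0, fun c _ => ⟨Fin.elim0, fun j => j.elim0, fun x x' i => i.elim0⟩⟩
  | succ s ih =>
    obtain ⟨n₁, h₁⟩ := ih
    obtain ⟨n₂, h₂⟩ := Combinatorics.Subspace.exists_mono_in_high_dimension_fin β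
      ((Fin n₁ → Option β) → K) Unit
    refine ⟨n₂ + n₁, fun c hc => ?_⟩
    obtain ⟨l, κ, hl⟩ := h₂ fun p u => c (Fin.append (fun i => some (p i)) u)
    have hκ : PrefixDetermined κ := by
      intro x x' i hx hx' hlt
      rw [← hl fun _ => Classical.arbitrary β]
      refine hc _ _ (Fin.natAdd n₂ i) (by simpa using hx) (by simpa using hx') fun j hj => ?_
      induction j using Fin.addCases with
      | left j => simp
      | right j => simpa using hlt j (by simpa using hj)
    obtain ⟨e', he', hd⟩ := h₁ κ hκ
    let e : Fin (n₂ + n₁) → β ⊕ Fin (s + 1) := Fin.append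
      (fun i => Sum.map id (fun _ => 0) (l.idxFun i)) fun j => Sum.map id Fin.succ (e' j)
    have h_app : ∀ x, app (lift e) x =
        Fin.append (fun i => Sum.elim some (fun _ => x 0) (l.idxFun i))
          (app (lift e') (Fin.tail x)) := by
      intro x
      funext i
      induction i using Fin.addCases with
      | left i =>
        simp only [app, lift, e, Fin.append_left]
        rcases l.idxFun i with b | j <;> simp
      | right i =>
        simp only [app, lift, e, Fin.append_right]
        rcases e' i with b | j <;> simp [Fin.tail]
    have h_some : ∀ x b, x 0 = some b →
        c (app (lift e) x) = κ (app (lift e') (Fin.tail x)) := by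
      intro x b hb
      rw [← hl fun _ => b, h_app]
      congr 2
      funext i
      simp only [hb, Combinatorics.Subspace.coe_apply]
      rcases l.idxFun i with b | j <;> simp
    refine ⟨e, ?_, ?_⟩
    · intro j
      refine Fin.cases ?_ (fun j => ?_) j
      · obtain ⟨i, hi⟩ := l.proper ()
        exact ⟨Fin.castAdd _ i, by simp [e, hi]⟩
      · obtain ⟨i, hi⟩ := he' j
        exact ⟨Fin.natAdd _ i, by simp [e, hi]⟩
    · intro x x' i hx hx' hlt
      obtain rfl | hi := eq_or_ne i 0
      · obtain ⟨i, hi⟩ := l.proper ()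
        simp only [h_app]
        refine hc _ _ (Fin.castAdd _ i) (by simp [hi, hx]) (by simp [hi, hx']) fun j hj => ?_
        induction j using Fin.addCases with
        | left j => simp [hx, hx']
        | right j =>
          simp only [Fin.lt_def, Fin.val_natAdd, Fin.val_castAdd] at hj
          omega
      · obtain ⟨j, rfl⟩ := Fin.exists_succ_eq.2 hi
        obtain ⟨h0, h0'⟩ := hlt 0 (Fin.succ_pos j)
        obtain ⟨b, hb⟩ := Option.ne_none_iff_exists'.1 h0
        obtain ⟨b', hb'⟩ := Option.ne_none_iff_exists'.1 h0'
        simp only [h_some x b hb, h_some x' b' hb']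
        exact hd _ _ j hx hx' fun k hk => hlt k.succ (Fin.succ_lt_succ_iff.2 hk)

/-- **Graham–Rothschild theorem** for combinatorial lines. -/
theorem exists_mono_variableWords (β : Type) [Finite β] [Nonempty β] (K : Type) [Finite K]
    [Nonempty K] (s : ℕ) : ∃ n : ℕ, ∀ c : (Fin n → Option β) → K,
      ∃ e : Fin n → β ⊕ Fin s, Proper e ∧
        ∃ κ, ∀ x, (∃ i, x i = none) → c (app (lift e) x) = κ := by
  classical
  have := Fintype.ofFinite K
  obtain ⟨n₁, h₁⟩ := exists_positionDetermined β K (Fintype.card K * s)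
  obtain ⟨n₂, h₂⟩ := exists_prefixDetermined β n₁ K
  refine ⟨n₂, fun c => ?_⟩
  obtain ⟨e₂, he₂, hc₂⟩ := h₂ c
  obtain ⟨e₁, he₁, hc₁⟩ := h₁ _ hc₂
  set c' : (Fin (Fintype.card K * s) → Option β) → K :=
    fun x => c (app (lift e₂) (app (lift e₁) x)) with hc'
  let b₀ : β := Classical.arbitrary β
  let col : Fin (Fintype.card K * s) → K := fun i => c' (Function.update (fun _ => some b₀) i none)
  obtain ⟨κ, hκ⟩ := Fintype.exists_le_card_fiber_of_mul_le_card col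
    (n := s) (by simp)
  obtain ⟨t, ht, hts⟩ := Finset.exists_subset_card_eq hκ
  let σ : t ≃ Fin s := Fintype.equivFinOfCardEq (by simpa using hts)
  let e₀ : Fin (Fintype.card K * s) → β ⊕ Fin s :=
    fun i => if h : i ∈ t then Sum.inr (σ ⟨i, h⟩) else Sum.inl b₀
  refine ⟨comp (comp e₂ e₁) e₀, (he₂.comp he₁).comp ?_, κ, fun x hx => ?_⟩
  · intro j
    exact ⟨σ.symm j, by simp [e₀]⟩
  · simp only [lift_comp, app_comp]
    set y := app (lift e₀) x with hy
    have hex : ∃ i, y i = none := by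
      obtain ⟨j, hj⟩ := hx
      exact ⟨σ.symm j, by simp [hy, app, lift, e₀, hj]⟩
    let i := Fin.find _ hex
    have hi : y i = none := Fin.find_spec hex
    have hit : i ∈ t := by
      by_contra h
      simp [hy, app, lift, e₀, h] at hi
    rw [← (Finset.mem_filter.1 (ht hit)).2]
    refine hc₁ y _ i hi (by simp) fun j hj => ⟨Fin.find_min hex hj, ?_⟩
    simp [Function.update_of_ne hj.ne]

open scoped BigOperators

/-! ### Densities -/

/-- The real-valued indicator of a set. -/
noncomputable def ind {X : Type} (A : Set X) (x : X) : ℝ := A.indicator 1 x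

/-- The density of a set in a finite type. -/
noncomputable def dens {X : Type} [Fintype X] (A : Set X) : ℝ := 𝔼 x, ind A x

theorem ind_of_mem {X : Type} {A : Set X} {x : X} (h : x ∈ A) : ind A x = 1 := by
  simp [ind, h]

theorem ind_of_notMem {X : Type} {A : Set X} {x : X} (h : x ∉ A) : ind A x = 0 := by
  simp [ind, h]

theorem ind_nonneg {X : Type} (A : Set X) (x : X) : 0 ≤ ind A x := by
  by_cases h : x ∈ A <;> simp [ind, h]

theorem ind_le_one {X : Type} (A : Set X) (x : X) : ind A x ≤ 1 := by
  by_cases h : x ∈ A <;> simp [ind, h]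

theorem dens_nonneg {X : Type} [Fintype X] (A : Set X) : 0 ≤ dens A :=
  Finset.expect_nonneg fun _ _ => ind_nonneg _ _

theorem dens_le_one {X : Type} [Fintype X] [Nonempty X] (A : Set X) : dens A ≤ 1 :=
  Finset.expect_le Finset.univ_nonempty fun _ _ => ind_le_one _ _

theorem nonempty_of_dens_pos {X : Type} [Fintype X] {A : Set X} (h : 0 < dens A) :
    A.Nonempty := by
  by_contra hA
  rw [Set.not_nonempty_iff_eq_empty] at hA
  simp [dens, hA, ind] at h

theorem dens_eq_ncard_div {X : Type} [Fintype X] (A : Set X) :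
    dens A = A.ncard / Fintype.card X := by
  classical
  rw [dens, Fintype.expect_eq_sum_div_card]
  congr 1
  simp [ind, Set.indicator_apply, Finset.sum_boole, Set.ncard_eq_toFinset_card']

theorem expect_sumArrow {A κ ι : Type} [Fintype A] [Fintype κ] [Fintype ι] [DecidableEq κ]
    [DecidableEq ι] (f : (κ ⊕ ι → A) → ℝ) : 𝔼 x, f x = 𝔼 u : ι → A, 𝔼 p : κ → A, f (Sum.elim p u) := by
  rw [Finset.expect_comm, ← Finset.expect_product', Finset.univ_product_univ]
  refine Fintype.expect_equiv (Equiv.sumArrowEquivProdArrow κ ι A) _ _ fun x => ?_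
  congr 1
  funext i
  cases i <;> rfl

/-- If many `y` have a large value `f y`, and each such `y` admits a valid configuration, then
some configuration is valid for many `y`. -/
theorem exists_popular {Y Φ : Type} [Fintype Y] [Nonempty Y] [Fintype Φ] (f : Y → ℝ)
    (valid : Φ → Set Y) {η : ℝ} (hη : 0 < η) (hf : ∀ y, f y ≤ 1)
    (hmean : η ≤ 𝔼 y, f y) (h : ∀ y, η / 2 ≤ f y → ∃ φ, y ∈ valid φ) :
    ∃ φ, η / 2 / Fintype.card Φ ≤ dens (valid φ) := by
  have key : ∀ y, f y ≤ η / 2 + ∑ φ, ind (valid φ) y := by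
    intro y
    have hnn : 0 ≤ ∑ φ, ind (valid φ) y := Finset.sum_nonneg fun _ _ => ind_nonneg _ _
    by_cases hy : η / 2 ≤ f y
    · obtain ⟨φ, hφ⟩ := h y hy
      have := Finset.single_le_sum (f := fun φ => ind (valid φ) y)
        (fun _ _ => ind_nonneg _ _) (Finset.mem_univ φ)
      simp only [ind_of_mem hφ] at this
      linarith [hf y]
    · linarith
  have hsum : η / 2 ≤ ∑ φ, dens (valid φ) := by
    have := hmean.trans (Finset.expect_le_expect fun y _ => key y)
    rw [Finset.expect_add_distrib, Fintype.expect_const, Finset.expect_sum_comm] at this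
    simp only [dens]
    linarith
  by_contra! hcon
  have hne : (Finset.univ : Finset Φ).Nonempty := by
    by_contra hne
    rw [Finset.not_nonempty_iff_eq_empty] at hne
    rw [hne, Finset.sum_empty] at hsum
    linarith
  have hlt := Finset.sum_lt_sum_of_nonempty hne fun φ _ => hcon φ
  have hpos : (0 : ℝ) < Fintype.card Φ := by exact_mod_cast Finset.card_pos.2 hne
  rw [Finset.sum_const, Finset.card_univ, nsmul_eq_mul, mul_div_cancel₀ _ hpos.ne'] at hlt
  linarith

/-! ### Density Hales–Jewett statements -/

/-- `A` contains a combinatorial line. -/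
def HasLine {A ι : Type} (S : Set (ι → A)) : Prop :=
  ∃ w : ι → Option A, (∃ i, w i = none) ∧ ∀ a, (fun i => (w i).getD a) ∈ S

/-- The density Hales–Jewett property at density `δ`. -/
def DHJAt (A : Type) [Fintype A] (δ : ℝ) : Prop :=
  ∃ N : ℕ, ∀ (ι : Type) [Fintype ι] [DecidableEq ι], N ≤ Fintype.card ι →
    ∀ S : Set (ι → A), δ ≤ dens S → HasLine S

/-- `S` contains an `M`-dimensional combinatorial subspace. -/
def HasSubspace {A ι : Type} (M : ℕ) (S : Set (ι → A)) : Prop :=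
  ∃ e : ι → A ⊕ Fin M, Proper e ∧ ∀ x, app e x ∈ S

theorem exists_equiv_sum {ι : Type} [Fintype ι] {n : ℕ} (h : n ≤ Fintype.card ι) :
    Nonempty (ι ≃ Fin n ⊕ Fin (Fintype.card ι - n)) := by
  refine ⟨(Fintype.equivFinOfCardEq ?_).trans finSumFinEquiv.symm⟩
  omega

theorem expect_arrow_congr {A ι κ : Type} [Fintype A] [Fintype κ] [Fintype ι] [DecidableEq κ]
    [DecidableEq ι] (σ : ι ≃ κ) (f : (ι → A) → ℝ) : 𝔼 x, f x = 𝔼 x : κ → A, f (x ∘ σ) := by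
  refine Fintype.expect_equiv (σ.arrowCongr (Equiv.refl A)) _ _ fun x => ?_
  congr 1
  funext i
  simp [Equiv.arrowCongr]

theorem dens_arrow_congr {A ι κ : Type} [Fintype A] [Fintype κ] [Fintype ι] [DecidableEq κ]
    [DecidableEq ι] (σ : ι ≃ κ) (S : Set (ι → A)) :
    dens S = dens {x : κ → A | x ∘ σ ∈ S} :=
  expect_arrow_congr σ _

theorem dens_sumArrow {A κ ι : Type} [Fintype A] [Fintype κ] [Fintype ι] [DecidableEq κ]
    [DecidableEq ι] (S : Set (κ ⊕ ι → A)) :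
    dens S = 𝔼 u : ι → A, dens {p : κ → A | Sum.elim p u ∈ S} :=
  expect_sumArrow _

theorem Proper.reindex {A ι κ η : Type} {e : κ → A ⊕ η} (he : Proper e) (σ : ι ≃ κ) :
    Proper fun i => e (σ i) := by
  intro j
  obtain ⟨i, hi⟩ := he j
  exact ⟨σ.symm i, by simp [hi]⟩

theorem HasSubspace.of_reindex {A ι κ : Type} {M : ℕ} (σ : ι ≃ κ) {S : Set (ι → A)}
    (h : HasSubspace M {x : κ → A | x ∘ σ ∈ S}) : HasSubspace M S := by
  obtain ⟨e, he, h⟩ := h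
  exact ⟨_, he.reindex σ, h⟩

theorem exists_hasSubspace {β : Type} [Fintype β] [Nonempty β] (hβ : ∀ δ > 0, DHJAt β δ)
    (M : ℕ) : ∀ η > 0, ∃ N : ℕ, ∀ (ι : Type) [Fintype ι] [DecidableEq ι], N ≤ Fintype.card ι →
      ∀ S : Set (ι → β), η ≤ dens S → HasSubspace M S := by
  induction M with
  | zero =>
    intro η hη
    refine ⟨0, fun ι _ _ _ S hS => ?_⟩
    obtain ⟨x, hx⟩ := nonempty_of_dens_pos (hη.trans_le hS)
    exact ⟨fun i => Sum.inl (x i), fun j => j.elim0, fun _ => hx⟩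
  | succ M ih =>
    intro η hη
    obtain ⟨N₁, h₁⟩ := hβ (η / 2) (by positivity)
    obtain ⟨N₂, h₂⟩ := ih (η / 2 / Fintype.card (Fin N₁ → Option β)) (by
      have : 0 < Fintype.card (Fin N₁ → Option β) := Fintype.card_pos
      positivity)
    refine ⟨N₁ + N₂, fun ι _ _ hι S hS => ?_⟩
    obtain ⟨σ⟩ := exists_equiv_sum (show N₁ ≤ Fintype.card ι by omega)
    refine HasSubspace.of_reindex σ ?_
    rw [dens_arrow_congr σ, dens_sumArrow] at hS
    set T : Set (Fin N₁ ⊕ Fin (Fintype.card ι - N₁) → β) := {x | x ∘ σ ∈ S}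
    obtain ⟨w, hw⟩ := exists_popular _
      (fun w : Fin N₁ → Option β => {u | (∃ i, w i = none) ∧
        ∀ a, Sum.elim (fun i => (w i).getD a) u ∈ T}) hη (fun u => dens_le_one _) hS
      fun u hu => h₁ (Fin N₁) (by simp) _ hu
    obtain ⟨e, he, hT⟩ := h₂ _ (by simp; omega) _ hw
    obtain ⟨⟨i₀, hi₀⟩, -⟩ := hT fun _ => Classical.arbitrary β
    refine ⟨Sum.elim (fun i => (w i).elim (Sum.inr 0) Sum.inl)
      fun i => Sum.map id Fin.succ (e i), ?_, fun x => ?_⟩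
    · intro j
      refine Fin.cases ⟨Sum.inl i₀, by simp [hi₀]⟩ (fun j => ?_) j
      obtain ⟨i, hi⟩ := he j
      exact ⟨Sum.inr i, by simp [hi]⟩
    · convert (hT (Fin.tail x)).2 (x 0) using 1
      funext i
      rcases i with i | i
      · simp only [app, Sum.elim_inl]
        cases w i <;> rfl
      · simp only [app, Sum.elim_inr]
        cases e i <;> rfl

/-! ### Insensitive sets -/

/-- Replace every `none` by `b`. -/
def fill {β ι : Type} (b : β) (x : ι → Option β) : ι → β := fun i => (x i).getD b

/-- Membership in `E` does not change when letters `none` and `b` are interchanged. -/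
def Insensitive {β ι : Type} (b : β) (E : Set (ι → Option β)) : Prop :=
  ∀ x y, fill b x = fill b y → (x ∈ E ↔ y ∈ E)

theorem Insensitive.compl {β ι : Type} {b : β} {E : Set (ι → Option β)} (h : Insensitive b E) :
    Insensitive b Eᶜ := fun x y hxy => not_congr (h x y hxy)

theorem Insensitive.preimage {β ι κ : Type} {b : β} {E : Set (ι → Option β)}
    (h : Insensitive b E) {g : (κ → Option β) → ι → Option β}
    (hg : ∀ x y, fill b x = fill b y → fill b (g x) = fill b (g y)) :
    Insensitive b (g ⁻¹' E) := fun x y hxy => h _ _ (hg x y hxy)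

theorem fill_app_congr {β ι η : Type} {b : β} (e : ι → Option β ⊕ η) {x y : η → Option β}
    (h : fill b x = fill b y) : fill b (app e x) = fill b (app e y) := by
  funext i
  simp only [fill, app]
  rcases e i with a | j
  · rfl
  · exact congrFun h j

theorem fill_sumElim_congr {β ι κ : Type} {b : β} {p p' : κ → Option β} {x y : ι → Option β}
    (hp : fill b p = fill b p') (h : fill b x = fill b y) :
    fill b (Sum.elim p x) = fill b (Sum.elim p' y) := by
  funext i
  rcases i with i | j
  · exact congrFun hp i
  · exact congrFun h j

theorem fill_comp_congr {β ι κ : Type} {b : β} (σ : ι → κ) {x y : κ → Option β}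
    (h : fill b x = fill b y) : fill b (x ∘ σ) = fill b (y ∘ σ) := by
  funext i
  exact congrFun h (σ i)

/-- Take the letter `none` where `v` has it, and the letter of `z` elsewhere. -/
def mix {β ι : Type} (v : ι → Option β) (z : ι → β) : ι → Option β :=
  fun i => (v i).map fun _ => z i

theorem expect_mix {β ι : Type} [Fintype β] [Nonempty β] [Fintype ι] [DecidableEq ι]
    (f : (ι → Option β) → ℝ) : 𝔼 v : ι → Option β, 𝔼 z : ι → β, f (mix v z) = 𝔼 x, f x := by
  have h : ∀ g : (ι → Option β) × (ι → β) → ℝ, 𝔼 v, 𝔼 z, g (v, z) = 𝔼 q, g q := fun g => by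
    rw [← Finset.expect_product', Finset.univ_product_univ]
  have swap : Function.Involutive fun q : (ι → Option β) × (ι → β) =>
      ((mix q.1 q.2, fun i => (q.1 i).getD (q.2 i)) : (ι → Option β) × (ι → β)) := by
    rintro ⟨v, z⟩
    simp only [mix, Prod.mk.injEq]
    constructor <;> funext i <;> cases hv : v i <;> simp [mix, hv]
  rw [h fun q => f (mix q.1 q.2)]
  calc 𝔼 q : (ι → Option β) × (ι → β), f (mix q.1 q.2)
      = 𝔼 q : (ι → Option β) × (ι → β), f q.1 :=
        Fintype.expect_equiv swap.toPerm _ _ fun q => rfl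
    _ = 𝔼 x, f x := by
        rw [← h fun q => f q.1]
        simp only [Fintype.expect_const]

theorem expect_prod {A ι : Type} [Fintype A] [Fintype ι] [DecidableEq ι] (w : A → ℝ) :
    𝔼 v : ι → A, ∏ i, w (v i) = (𝔼 a, w a) ^ Fintype.card ι := by
  have := Finset.prod_univ_sum (fun _ : ι => (Finset.univ : Finset A)) fun _ a => w a
  rw [Fintype.piFinset_univ] at this
  rw [Fintype.expect_eq_sum_div_card, ← this, Finset.prod_const, Finset.card_univ,
    Fintype.expect_eq_sum_div_card, div_pow]
  congr 1
  simp

theorem expect_prod_some_le {β : Type} [Fintype β] [Nonempty β] (n : ℕ) :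
    ∃ r : ℝ, 0 ≤ r ∧ r < 1 ∧ ∀ (ι : Type) [Fintype ι] [DecidableEq ι],
      dens {v : ι → Option β | Fintype.card {i // v i ≠ none} < n} ≤
        2 ^ n * r ^ Fintype.card ι := by
  classical
  let w : Option β → ℝ := fun a => if a = none then 1 else 1 / 2
  have hcard : (1 : ℝ) ≤ Fintype.card β := by exact_mod_cast Fintype.card_pos
  have hw : ∑ a, w a = 1 + Fintype.card β / 2 := by
    simp [w, Fintype.sum_option]
    ring
  refine ⟨(1 + Fintype.card β / 2) / (1 + Fintype.card β), by positivity, ?_, ?_⟩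
  · rw [div_lt_one (by positivity)]
    linarith
  intro ι _ _
  have hprod : ∀ v : ι → Option β, ∏ i, w (v i) = (1 / 2) ^ Fintype.card {i // v i ≠ none} := by
    intro v
    simp only [w]
    rw [Finset.prod_ite, Finset.prod_const_one, one_mul, Finset.prod_const, Fintype.card_subtype]
  have hle : ∀ v : ι → Option β,
      ind {v : ι → Option β | Fintype.card {i // v i ≠ none} < n} v ≤ 2 ^ n * ∏ i, w (v i) := by
    intro v
    rw [hprod]
    by_cases hv : Fintype.card {i // v i ≠ none} < n
    · rw [ind_of_mem (by exact hv), one_div, inv_pow, ← div_eq_mul_inv, one_le_div (by positivity)]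
      exact pow_le_pow_right₀ (by norm_num) hv.le
    · rw [ind_of_notMem (by exact hv)]
      positivity
  refine (Finset.expect_le_expect fun v _ => hle v).trans_eq ?_
  rw [← Finset.mul_expect, expect_prod, Fintype.expect_eq_sum_div_card, hw]
  simp [add_comm]

theorem exists_pow_le {r η : ℝ} (hr : 0 ≤ r) (hr1 : r < 1) (C : ℝ) (hη : 0 < η) :
    ∃ N : ℕ, ∀ n ≥ N, C * r ^ n ≤ η := by
  have h := (tendsto_pow_atTop_nhds_zero_of_lt_one hr hr1).const_mul C
  rw [mul_zero] at h
  exact Filter.eventually_atTop.1 (h.eventually_le_const hη)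

/-- A dense insensitive set contains a combinatorial subspace over the larger alphabet. -/
theorem exists_hasSubspace_of_insensitive {β : Type} [Fintype β] [Nonempty β]
    (hβ : ∀ δ > 0, DHJAt β δ) (M : ℕ) {η : ℝ} (hη : 0 < η) :
    ∃ N : ℕ, ∀ (ι : Type) [Fintype ι] [DecidableEq ι], N ≤ Fintype.card ι →
      ∀ (b : β) (E : Set (ι → Option β)), Insensitive b E → η ≤ dens E → HasSubspace M E := by
  obtain ⟨N₁, h₁⟩ := exists_hasSubspace hβ M (η / 2) (by positivity)
  obtain ⟨r, hr, hr1, hdens⟩ := expect_prod_some_le (β := β) N₁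
  obtain ⟨N, hN⟩ := exists_pow_le hr hr1 (2 ^ N₁) (show 0 < η / 4 by positivity)
  refine ⟨N, fun ι _ _ hι b E hE hd => ?_⟩
  classical
  obtain ⟨v, hv, hvE⟩ : ∃ v : ι → Option β, N₁ ≤ Fintype.card {i // v i ≠ none} ∧
      η / 2 ≤ dens {z : ι → β | mix v z ∈ E} := by
    by_contra! hcon
    have hle : ∀ v : ι → Option β, dens {z : ι → β | mix v z ∈ E} ≤
        η / 2 + ind {v : ι → Option β | Fintype.card {i // v i ≠ none} < N₁} v := by
      intro v
      by_cases hv : Fintype.card {i // v i ≠ none} < N₁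
      · rw [ind_of_mem (by exact hv)]
        linarith [dens_le_one {z : ι → β | mix v z ∈ E}]
      · rw [ind_of_notMem (by exact hv)]
        linarith [hcon v (not_lt.1 hv)]
    have h := Finset.expect_le_expect (s := Finset.univ) fun v _ => hle v
    rw [Finset.expect_add_distrib, Fintype.expect_const] at h
    have h' : 𝔼 v : ι → Option β, dens {z : ι → β | mix v z ∈ E} = dens E := expect_mix (ind E)
    have h'' := (hdens ι).trans (hN _ hι)
    simp only [dens] at h h' h'' hd
    linarith
  let σ := (Equiv.sumCompl fun i => v i ≠ none).symm
  rw [dens_arrow_congr σ, dens_sumArrow] at hvE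
  obtain ⟨u, -, hu⟩ := Finset.exists_le_of_le_expect Finset.univ_nonempty hvE
  obtain ⟨e, he, hT⟩ := h₁ _ hv _ hu
  refine ⟨fun i => if h : v i ≠ none then lift e ⟨i, h⟩ else Sum.inl none, ?_, fun x => ?_⟩
  · intro j
    obtain ⟨i, hi⟩ := he.lift j
    exact ⟨i, (dif_pos i.2).trans hi⟩
  · refine (hE _ _ ?_).1 (hT (fill b x))
    funext i
    by_cases h : v i = none
    · simp [fill, mix, app, h]
    · obtain ⟨c, hc⟩ := Option.ne_none_iff_exists'.1 h
      have hσ : σ i = Sum.inl ⟨i, h⟩ := Equiv.sumCompl_symm_apply_of_pos (p := fun i => v i ≠ none) h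
      simp only [fill, mix, app, hc, Option.map_some, Function.comp, hσ, Sum.elim_inl, lift]
      rcases he' : e ⟨i, h⟩ with a | j <;> simp [he', fill]

/-! ### Functions with nonpositive mean on subspaces -/

/-- `g` has nonpositive mean on every `M`-dimensional combinatorial subspace. -/
def NonposOnSubspaces {A ι : Type} [Fintype A] (M : ℕ) (g : (ι → A) → ℝ) : Prop :=
  ∀ e : ι → A ⊕ Fin M, Proper e → 𝔼 x, g (app e x) ≤ 0

theorem NonposOnSubspaces.comp {A ι η : Type} [Fintype A] {M : ℕ} {g : (ι → A) → ℝ}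
    (hg : NonposOnSubspaces M g) {e : ι → A ⊕ η} (he : Proper e) :
    NonposOnSubspaces M fun x => g (app e x) := by
  intro f hf
  simpa only [app_comp] using hg _ (he.comp hf)

theorem proper_sumElim_inl {A κ ι : Type} (p : κ → A) :
    Proper (Sum.elim (fun i => Sum.inl (p i)) Sum.inr : κ ⊕ ι → A ⊕ ι) :=
  fun j => ⟨Sum.inr j, rfl⟩

theorem app_sumElim_inl {A κ ι : Type} (p : κ → A) (x : ι → A) :
    app (Sum.elim (fun i => Sum.inl (p i)) Sum.inr : κ ⊕ ι → A ⊕ ι) x = Sum.elim p x := by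
  funext i
  cases i <;> rfl

theorem proper_sumElim_inr {A κ ι η : Type} {e : κ → A ⊕ η} (he : Proper e) (u : ι → A) :
    Proper (Sum.elim e (fun i => Sum.inl (u i)) : κ ⊕ ι → A ⊕ η) := by
  intro j
  obtain ⟨i, hi⟩ := he j
  exact ⟨Sum.inl i, hi⟩

theorem app_sumElim_inr {A κ ι η : Type} (e : κ → A ⊕ η) (u : ι → A) (x : η → A) :
    app (Sum.elim e (fun i => Sum.inl (u i)) : κ ⊕ ι → A ⊕ η) x = Sum.elim (app e x) u := by
  funext i
  cases i <;> rfl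

theorem expect_ind_range_mul {X Z : Type} [Fintype X] [Nonempty X] [Fintype Z] {j : X → Z}
    (hj : Function.Injective j) (h : Z → ℝ) :
    𝔼 z, ind (Set.range j) z * h z = Fintype.card X / Fintype.card Z * 𝔼 x, h (j x) := by
  classical
  have hsum : ∑ z, ind (Set.range j) z * h z = ∑ x, h (j x) := by
    rw [← Finset.sum_image (s := Finset.univ) (f := h) (g := j) hj.injOn,
      ← Finset.sum_subset (Finset.subset_univ (Finset.univ.image j))]
    · refine Finset.sum_congr rfl fun z hz => ?_
      rw [ind_of_mem (by simpa using hz), one_mul]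
    · intro z _ hz
      rw [ind_of_notMem (by simpa using hz), zero_mul]
  rw [Fintype.expect_eq_sum_div_card, Fintype.expect_eq_sum_div_card, hsum]
  have : (Fintype.card X : ℝ) ≠ 0 := by exact_mod_cast Fintype.card_ne_zero
  field_simp

theorem expect_ind_mul_le_dens {X : Type} [Fintype X] (E : Set X) {g : X → ℝ}
    (hg : ∀ x, g x ≤ 1) : 𝔼 x, ind E x * g x ≤ dens E :=
  Finset.expect_le_expect fun x _ => mul_le_of_le_one_right (ind_nonneg E x) (hg x)

theorem dens_range {X Z : Type} [Fintype X] [Nonempty X] [Fintype Z] {j : X → Z}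
    (hj : Function.Injective j) :
    dens (Set.range j) = Fintype.card X / Fintype.card Z := by
  have := expect_ind_range_mul hj fun _ => 1
  simpa [dens] using this

/-- From a dense insensitive set one can remove a union of parallel subspaces, so that the
fibres stay insensitive. -/
theorem exists_remove_subspaces {β κ ι : Type} [Fintype β] [Fintype κ] [DecidableEq κ]
    [Fintype ι] [DecidableEq ι] {M : ℕ} {η : ℝ} (hη : 0 < η) {b : β}
    (h : ∀ E : Set (κ → Option β), Insensitive b E → η / 2 ≤ dens E → HasSubspace M E)
    {E : Set (κ ⊕ ι → Option β)} (hE : Insensitive b E) (hd : η ≤ dens E)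
    {g : (κ ⊕ ι → Option β) → ℝ} (hg : NonposOnSubspaces M g) :
    ∃ E' : Set (κ ⊕ ι → Option β), (∀ p : κ → Option β, Insensitive b {u | Sum.elim p u ∈ E'}) ∧
      dens E' ≤ dens E -
        η / 2 / Fintype.card (κ → Option β ⊕ Fin M) / Fintype.card (κ → Option β) ∧
      𝔼 x, ind E x * g x ≤ 𝔼 x, ind E' x * g x := by
  classical
  rw [dens_sumArrow] at hd
  obtain ⟨e, he⟩ := exists_popular _
    (fun e : κ → Option β ⊕ Fin M => {u | Proper e ∧ ∀ x, Sum.elim (app e x) u ∈ E}) hη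
    (fun u => dens_le_one _) hd fun u hu =>
      h _ (hE.preimage fun x y hxy => fill_sumElim_congr hxy rfl) hu
  set Y : Set (ι → Option β) := {u | Proper e ∧ ∀ x, Sum.elim (app e x) u ∈ E} with hYdef
  have hΦ : (0 : ℝ) < Fintype.card (κ → Option β ⊕ Fin M) := by
    exact_mod_cast Fintype.card_pos_iff.2 ⟨e⟩
  have hYpos : 0 < dens Y := lt_of_lt_of_le (by positivity) he
  obtain ⟨-, hprop, -⟩ := nonempty_of_dens_pos hYpos
  set I : Set (κ → Option β) := Set.range (app e)
  have hIY : ∀ p ∈ I, ∀ u ∈ Y, Sum.elim p u ∈ E := by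
    rintro _ ⟨x, rfl⟩ u hu
    exact hu.2 x
  have hYins : Insensitive b Y := fun u v huv =>
    and_congr Iff.rfl (forall_congr' fun x => hE _ _ (fill_sumElim_congr rfl huv))
  set E' : Set (κ ⊕ ι → Option β) := {x ∈ E | ¬ (x ∘ Sum.inl ∈ I ∧ x ∘ Sum.inr ∈ Y)}
  have hsplit : ∀ u p, ind E (Sum.elim p u) = ind E' (Sum.elim p u) + ind I p * ind Y u := by
    intro u p
    by_cases hp : p ∈ I
    · by_cases hu : u ∈ Y
      · rw [ind_of_mem (hIY p hp u hu), ind_of_mem hp, ind_of_mem hu, ind_of_notMem]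
        · norm_num
        · exact fun hx => hx.2 ⟨hp, hu⟩
      · rw [ind_of_notMem hu, mul_zero, add_zero]
        simp [ind, E', Set.indicator_apply, hu]
    · rw [ind_of_notMem hp, zero_mul, add_zero]
      simp [ind, E', Set.indicator_apply, hp]
  have hinj := hprop.app_injective
  refine ⟨E', fun p u v huv => ?_, ?_, ?_⟩
  · exact and_congr (hE _ _ (fill_sumElim_congr rfl huv))
      (not_congr (and_congr Iff.rfl (hYins _ _ huv)))
  · have hdens : dens E = dens E' + dens I * dens Y := by
      simp only [dens]
      rw [expect_sumArrow, expect_sumArrow (ind E')]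
      simp only [hsplit, Finset.expect_add_distrib, ← Finset.expect_mul, ← Finset.mul_expect]
    have hI : 1 / (Fintype.card (κ → Option β) : ℝ) ≤ dens I := by
      rw [dens_range hinj]
      gcongr
      exact_mod_cast Fintype.card_pos
    rw [hdens, div_eq_mul_one_div _ (Fintype.card (κ → Option β) : ℝ)]
    nlinarith [mul_le_mul he hI (by positivity) (dens_nonneg Y)]
  · rw [expect_sumArrow, expect_sumArrow fun x => ind E' x * g x]
    refine Finset.expect_le_expect fun u _ => ?_
    simp only [hsplit, add_mul, Finset.expect_add_distrib]
    have hcell := hg _ (proper_sumElim_inr hprop u)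
    simp only [app_sumElim_inr] at hcell
    have : 𝔼 p, ind I p * ind Y u * g (Sum.elim p u) ≤ 0 := by
      have h1 : ∀ p, ind I p * ind Y u * g (Sum.elim p u) =
          ind Y u * (ind I p * g (Sum.elim p u)) := fun p => by ring
      simp only [h1, ← Finset.mul_expect]
      rw [expect_ind_range_mul hinj fun p => g (Sum.elim p u)]
      exact mul_nonpos_of_nonneg_of_nonpos (ind_nonneg _ _)
        (mul_nonpos_of_nonneg_of_nonpos (by positivity) hcell)
    linarith

theorem NonposOnSubspaces.reindex {A ι κ : Type} [Fintype A] {M : ℕ} {g : (ι → A) → ℝ}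
    (hg : NonposOnSubspaces M g) (σ : ι ≃ κ) : NonposOnSubspaces M fun x : κ → A => g (x ∘ σ) :=
  fun _ he => hg _ (he.reindex σ)

theorem NonposOnSubspaces.fiber {A ι κ : Type} [Fintype A] {M : ℕ} {g : (κ ⊕ ι → A) → ℝ}
    (hg : NonposOnSubspaces M g) (p : κ → A) :
    NonposOnSubspaces M fun u : ι → A => g (Sum.elim p u) := by
  simpa only [app_sumElim_inl] using hg.comp (proper_sumElim_inl p)

section

variable {β : Type} [Fintype β] [Nonempty β]

theorem expect_insensitive_le_pow (hβ : ∀ δ > 0, DHJAt β δ) (M : ℕ) {η : ℝ} (hη : 0 < η)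
    (hη1 : η ≤ 1) : ∃ q : ℝ, 0 ≤ q ∧ q < 1 ∧ ∀ r : ℕ, ∃ N : ℕ,
      ∀ (ι : Type) [Fintype ι] [DecidableEq ι], N ≤ Fintype.card ι →
      ∀ (b : β) (g : (ι → Option β) → ℝ), (∀ x, g x ≤ 1) ∧ NonposOnSubspaces M g →
      ∀ E, Insensitive b E → 𝔼 x, ind E x * g x ≤ q ^ r * dens E + η := by
  classical
  obtain ⟨N₀, h₀⟩ := exists_hasSubspace_of_insensitive hβ M (show 0 < η / 2 by positivity)
  set Φ := Fin N₀ → Option β ⊕ Fin M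
  set Z := Fin N₀ → Option β
  have hΦ : (1 : ℝ) ≤ Fintype.card Φ := by exact_mod_cast Fintype.card_pos
  have hZ : (1 : ℝ) ≤ Fintype.card Z := by exact_mod_cast Fintype.card_pos
  set c : ℝ := η / 2 / Fintype.card Φ / Fintype.card Z with hc
  have hc0 : 0 < c := by positivity
  have hc1 : c ≤ 1 := by
    refine (div_le_self (by positivity) hZ).trans ((div_le_self (by positivity) hΦ).trans ?_)
    linarith
  refine ⟨1 - c, by linarith, by linarith, fun r => ?_⟩
  induction r with
  | zero =>
    refine ⟨0, fun ι _ _ _ b g hg E _ => ?_⟩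
    linarith [expect_ind_mul_le_dens E hg.1]
  | succ r ih =>
    obtain ⟨N₁, h₁⟩ := ih
    refine ⟨N₀ + N₁, fun ι _ _ hι b g hg E hE => ?_⟩
    have hq : 0 ≤ (1 - c) ^ (r + 1) := pow_nonneg (by linarith) _
    by_cases hsmall : dens E ≤ η
    · have := mul_nonneg hq (dens_nonneg E)
      linarith [expect_ind_mul_le_dens E hg.1]
    obtain ⟨σ⟩ := exists_equiv_sum (show N₀ ≤ Fintype.card ι by omega)
    have hι' : N₁ ≤ Fintype.card (Fin (Fintype.card ι - N₀)) := by simp; omega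
    rw [dens_arrow_congr σ, expect_arrow_congr σ]
    rw [dens_arrow_congr σ] at hsmall
    obtain ⟨E', hins, hdens, hle⟩ := exists_remove_subspaces hη
      (fun E hE => h₀ (Fin N₀) (by simp) b E hE)
      (hE.preimage (g := fun x => x ∘ σ) fun _ _ => fill_comp_congr σ) (not_le.1 hsmall).le
      (hg.2.reindex σ)
    refine hle.trans ?_
    have hE1 : dens {x | x ∘ σ ∈ E} ≤ 1 := dens_le_one _
    have hfib : 𝔼 x, ind E' x * g (x ∘ σ) ≤ (1 - c) ^ r * dens E' + η := by
      rw [expect_sumArrow, Finset.expect_comm, dens_sumArrow]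
      simp only [dens]
      rw [Finset.expect_comm (f := fun u p => ind {p | Sum.elim p u ∈ E'} p), Finset.mul_expect]
      rw [← Fintype.expect_const (ι := Z) η, ← Finset.expect_add_distrib]
      exact Finset.expect_le_expect fun p _ => h₁ _ hι' b _
        ⟨fun x => hg.1 _, (hg.2.reindex σ).fiber p⟩ _ (hins p)
    refine hfib.trans ?_
    have : dens E' ≤ (1 - c) * dens {x | x ∘ σ ∈ E} := by
      have : dens E' ≤ dens {x | x ∘ σ ∈ E} - c := hdens
      nlinarith
    have := mul_le_mul_of_nonneg_left this (show 0 ≤ (1 - c) ^ r from pow_nonneg (by linarith) r)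
    rw [pow_succ]
    linarith

theorem expect_insensitive_le (hβ : ∀ δ > 0, DHJAt β δ) (M : ℕ) {η : ℝ} (hη : 0 < η) :
    ∃ N : ℕ, ∀ (ι : Type) [Fintype ι] [DecidableEq ι], N ≤ Fintype.card ι →
      ∀ (b : β) (g : (ι → Option β) → ℝ), (∀ x, g x ≤ 1) ∧ NonposOnSubspaces M g →
      ∀ E, Insensitive b E → 𝔼 x, ind E x * g x ≤ η := by
  have hη' : 0 < min η 1 := by positivity
  obtain ⟨q, hq, hq1, h⟩ := expect_insensitive_le_pow hβ M (half_pos hη')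
    (by linarith [min_le_right η 1])
  obtain ⟨r, hr⟩ := exists_pow_le hq hq1 1 (half_pos hη')
  obtain ⟨N, hN⟩ := h r
  refine ⟨N, fun ι _ _ hι b g hg E hE => (hN ι hι b g hg E hE).trans ?_⟩
  have := mul_le_of_le_one_right (pow_nonneg hq r) (dens_le_one E)
  linarith [hr r le_rfl, min_le_left η 1]

end

/-! ### Bounds on intersections of insensitive sets -/

section

variable {β : Type} [Fintype β] [Nonempty β]

theorem NonposOnSubspaces.expect_nonpos {A ι : Type} [Fintype A] [Fintype ι] [DecidableEq ι]
    {M : ℕ} {g : (ι → A) → ℝ} (hg : NonposOnSubspaces M g) (hι : M ≤ Fintype.card ι) :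
    𝔼 x, g x ≤ 0 := by
  obtain ⟨σ⟩ := exists_equiv_sum hι
  rw [expect_arrow_congr σ, expect_sumArrow]
  refine (Finset.expect_le_expect (g := fun _ => 0) fun u _ => ?_).trans (by simp)
  have := hg.reindex σ _ (proper_sumElim_inr (e := Sum.inr) (fun j => ⟨j, rfl⟩) u)
  simp only [app_sumElim_inr] at this
  exact this

theorem expect_inter_insensitive_le (hβ : ∀ δ > 0, DHJAt β δ) (S : Finset β) :
    ∀ (M : ℕ) (η : ℝ), 0 < η → ∃ N : ℕ, ∀ (ι : Type) [Fintype ι] [DecidableEq ι],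
      N ≤ Fintype.card ι → ∀ g : (ι → Option β) → ℝ,
      (∀ x, g x ≤ 1) ∧ NonposOnSubspaces M g →
      ∀ E : β → Set (ι → Option β), (∀ b ∈ S, Insensitive b (E b)) →
        𝔼 x, ind {x | ∀ b ∈ S, x ∈ E b} x * g x ≤ η := by
  classical
  induction S using Finset.induction_on with
  | empty =>
    intro M η hη
    refine ⟨M, fun ι _ _ hι g hg E _ => ?_⟩
    simpa [ind] using (hg.2.expect_nonpos hι).trans hη.le
  | insert b S _ ih =>
    intro M η hη
    obtain ⟨M₁, h₁⟩ := ih M (η / 2) (by positivity)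
    obtain ⟨N, hN⟩ := expect_insensitive_le hβ M₁ (show 0 < η / 2 by positivity)
    refine ⟨N, fun ι _ _ hι g hg E hE => ?_⟩
    set T := {x | ∀ b ∈ S, x ∈ E b}
    have hT : ∀ x, ind T x * g x ≤ 1 := fun x =>
      (mul_le_of_le_one_right (ind_nonneg T x) (hg.1 x)).trans (ind_le_one T x)
    have h := hN ι hι b (fun x => ind T x * g x - η / 2)
      ⟨fun x => by linarith [hT x], fun e he => ?_⟩ (E b) (hE b (Finset.mem_insert_self b S))
    · have hle : ∀ x, ind {x | ∀ c ∈ insert b S, x ∈ E c} x * g x ≤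
          ind (E b) x * (ind T x * g x - η / 2) + η / 2 := by
        intro x
        have : ind {x | ∀ c ∈ insert b S, x ∈ E c} x = ind (E b) x * ind T x := by
          by_cases h1 : x ∈ E b <;> by_cases h2 : x ∈ T
          · rw [ind_of_mem h1, ind_of_mem h2, ind_of_mem]
            · norm_num
            · exact Finset.forall_mem_insert _ _ _ |>.2 ⟨h1, h2⟩
          · rw [ind_of_notMem h2, ind_of_notMem, mul_zero]
            exact fun h => h2 fun c hc => h c (Finset.mem_insert_of_mem hc)
          all_goals
            rw [ind_of_notMem h1, ind_of_notMem, zero_mul]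
            exact fun h => h1 (h b (Finset.mem_insert_self b S))
        rw [this]
        nlinarith [ind_le_one (E b) x]
      refine (Finset.expect_le_expect fun x _ => hle x).trans ?_
      rw [Finset.expect_add_distrib, Fintype.expect_const]
      linarith
    · have := h₁ (Fin M₁) (by simp) (fun x => g (app e x)) ⟨fun x => hg.1 _, hg.2.comp he⟩
        (fun c => app e ⁻¹' E c) fun c hc =>
          (hE c (Finset.mem_insert_of_mem hc)).preimage fun _ _ => fill_app_congr e
      rw [Finset.expect_sub_distrib, Fintype.expect_const]
      exact sub_nonpos.2 this

theorem expect_compl_inter_insensitive_le (hβ : ∀ δ > 0, DHJAt β δ) (M : ℕ) {η : ℝ}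
    (hη : 0 < η) : ∃ N : ℕ, ∀ (ι : Type) [Fintype ι] [DecidableEq ι],
      N ≤ Fintype.card ι → ∀ g : (ι → Option β) → ℝ,
      (∀ x, g x ≤ 1) ∧ NonposOnSubspaces M g →
      ∀ E : β → Set (ι → Option β), (∀ b, Insensitive b (E b)) →
        𝔼 x, ind {x | ∀ b, x ∈ E b}ᶜ x * g x ≤ Fintype.card β * η := by
  classical
  choose N hN using fun S : Finset β => expect_inter_insensitive_le hβ S M η hη
  refine ⟨Finset.univ.sup N, fun ι _ _ hι g hg E hE => ?_⟩
  have key : ∀ S : Finset β,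
      𝔼 x, ind {x | ∀ b ∈ S, x ∈ E b}ᶜ x * g x ≤ S.card * η := by
    intro S
    induction S using Finset.induction_on with
    | empty => simp [ind]
    | insert b S hb ih =>
      let E' := Function.update E b (E b)ᶜ
      have hE' : ∀ c, Insensitive c (E' c) := by
        intro c
        by_cases hc : c = b
        · subst hc
          simpa [E'] using (hE c).compl
        · simpa [E', hc] using hE c
      have h := hN (insert b S) ι ((Finset.le_sup (Finset.mem_univ _)).trans hι) g hg E'
        fun c _ => hE' c
      have hmem : ∀ x, (∀ c ∈ insert b S, x ∈ E' c) ↔ x ∉ E b ∧ ∀ c ∈ S, x ∈ E c := by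
        intro x
        rw [Finset.forall_mem_insert]
        refine and_congr (by simp [E']) (forall₂_congr fun c hc => ?_)
        rw [show E' c = E c from Function.update_of_ne (ne_of_mem_of_not_mem hc hb) _ _]
      have hsplit : ∀ x, ind {x | ∀ c ∈ insert b S, x ∈ E c}ᶜ x =
          ind {x | ∀ c ∈ S, x ∈ E c}ᶜ x + ind {x | ∀ c ∈ insert b S, x ∈ E' c} x := by
        intro x
        have hmem' : (∀ c ∈ insert b S, x ∈ E c) ↔ x ∈ E b ∧ ∀ c ∈ S, x ∈ E c :=
          Finset.forall_mem_insert _ _ _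
        simp only [ind, Set.indicator_apply, Set.mem_compl_iff, Set.mem_ofPred_eq, hmem', hmem]
        split_ifs <;> first | tauto | simp
      simp only [hsplit, add_mul, Finset.expect_add_distrib, Finset.card_insert_of_notMem hb]
      push_cast
      linarith
  simpa using key Finset.univ

end

/-! ### The density increment -/

theorem DHJAt.mono {A : Type} [Fintype A] {δ ε : ℝ} (h : DHJAt A δ) (hδ : δ ≤ ε) :
    DHJAt A ε := by
  obtain ⟨N, h⟩ := h
  exact ⟨N, fun ι _ _ hι S hS => h ι hι S (hδ.trans hS)⟩

theorem HasLine.of_app {A ι η : Type} {e : ι → A ⊕ η} (he : Proper e) {S : Set (ι → A)}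
    (h : HasLine {x | app e x ∈ S}) : HasLine S := by
  obtain ⟨w, ⟨j, hj⟩, hw⟩ := h
  obtain ⟨i, hi⟩ := he j
  refine ⟨fun i => Sum.elim some w (e i), ⟨i, by simpa [hi] using hj⟩, fun a => ?_⟩
  convert show app e _ ∈ S from hw a using 1
  funext i
  simp only [app]
  cases e i <;> rfl

theorem HasLine.of_reindex {A ι κ : Type} (σ : ι ≃ κ) {S : Set (ι → A)}
    (h : HasLine {x : κ → A | x ∘ σ ∈ S}) : HasLine S :=
  HasLine.of_app (e := fun i => Sum.inr (σ i)) (fun j => ⟨σ.symm j, by simp⟩) h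

theorem fill_app_lift {β ι η : Type} (b : β) (e : ι → β ⊕ η) (x : η → Option β) :
    fill b (app (lift e) x) = app e (fill b x) := by
  funext i
  simp only [fill, app, lift]
  cases e i <;> rfl

theorem le_dens_slice {A κ ι : Type} [Fintype A] [Fintype κ] [DecidableEq κ] [Fintype ι]
    [DecidableEq ι] {S : Set (κ ⊕ ι → A)} {d τ : ℝ} (hS : d - τ ≤ dens S)
    (h : ∀ p : κ → A, dens {u : ι → A | Sum.elim p u ∈ S} ≤ d + τ) (p : κ → A) :
    d - 2 * Fintype.card (κ → A) * τ ≤ dens {u : ι → A | Sum.elim p u ∈ S} := by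
  have hP : (1 : ℝ) ≤ Fintype.card (κ → A) := by
    exact_mod_cast Fintype.card_pos_iff.2 ⟨p⟩
  have : Nonempty (κ → A) := ⟨p⟩
  have hmean : 𝔼 p, (d + τ - dens {u : ι → A | Sum.elim p u ∈ S}) ≤ 2 * τ := by
    rw [Finset.expect_sub_distrib, Fintype.expect_const]
    have : 𝔼 p, dens {u : ι → A | Sum.elim p u ∈ S} = dens S := by
      simp only [dens]
      rw [expect_sumArrow, Finset.expect_comm]
      rfl
    linarith
  have hle := Finset.single_le_sum
    (f := fun p => d + τ - dens {u : ι → A | Sum.elim p u ∈ S})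
    (fun q _ => sub_nonneg.2 (h q)) (Finset.mem_univ p)
  rw [Fintype.expect_eq_sum_div_card, div_le_iff₀ (by linarith)] at hmean
  have hτ : 0 ≤ τ := by
    have : 0 ≤ 2 * τ * Fintype.card (κ → A) :=
      (Finset.sum_nonneg fun q _ => sub_nonneg.2 (h q)).trans hmean
    nlinarith
  linarith

section

variable {β : Type} [Fintype β] [Nonempty β]

/-- If all slices of `A` are dense, then on some subspace, each variable word over `β`
defines a `β`-line that is contained in many slices. -/
theorem exists_rich_subspace {d : ℝ} (hd : 0 < d) {N m s : ℕ}
    (hN : ∀ S : Set (Fin N → β), d / 4 ≤ dens S → HasLine S) (hs : N ≤ s)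
    (hm : ∀ c : (Fin m → Option β) → Prop, ∃ e : Fin m → β ⊕ Fin s, Proper e ∧
      ∃ κ, ∀ x, (∃ i, x i = none) → c (app (lift e) x) = κ)
    {ι : Type} [Fintype ι] [DecidableEq ι] (A : Set (Fin m ⊕ ι → Option β))
    (hA : ∀ p : Fin m → Option β, d / 2 ≤ dens {u : ι → Option β | Sum.elim p u ∈ A}) :
    ∃ e : Fin m → β ⊕ Fin s, Proper e ∧ ∀ x, (∃ i, x i = none) →
      d / 4 / Fintype.card (Fin N → Option β) ≤
        dens {u : ι → Option β | ∀ b, Sum.elim (some ∘ fill b (app (lift e) x)) u ∈ A} := by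
  obtain ⟨e, he, κ, hκ⟩ := hm fun w => d / 4 / Fintype.card (Fin N → Option β) ≤
    dens {u : ι → Option β | ∀ b, Sum.elim (some ∘ fill b w) u ∈ A}
  refine ⟨e, he, fun x hx => ?_⟩
  rw [hκ x hx]
  let f : Fin s → β ⊕ Fin N := fun i =>
    if h : (i : ℕ) < N then Sum.inr ⟨i, h⟩ else Sum.inl (Classical.arbitrary β)
  have hf : Proper f := fun j => ⟨Fin.castLE hs j, by simp [f]⟩
  have hmean : d / 2 ≤ 𝔼 u : ι → Option β,
      dens {y : Fin N → β | Sum.elim (some ∘ app e (app f y)) u ∈ A} := by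
    simp only [dens]
    rw [Finset.expect_comm]
    exact Finset.le_expect Finset.univ_nonempty fun y _ => hA _
  obtain ⟨w, hw⟩ := exists_popular _
    (fun w : Fin N → Option β => {u : ι → Option β | (∃ i, w i = none) ∧
      ∀ b, Sum.elim (some ∘ app e (app f (fill b w))) u ∈ A}) (half_pos hd)
    (fun u => dens_le_one _) hmean fun u hu =>
      let ⟨w, hi, hw⟩ := hN _ ((show d / 4 = d / 2 / 2 by ring).le.trans hu)
      ⟨w, hi, hw⟩
  have hpos : 0 < d / 2 / 2 / Fintype.card (Fin N → Option β) := by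
    have : 0 < Fintype.card (Fin N → Option β) := Fintype.card_pos
    positivity
  obtain ⟨-, ⟨i, hi⟩, -⟩ := nonempty_of_dens_pos (hpos.trans_le hw)
  obtain ⟨j, hj⟩ := hf i
  rw [← hκ (app (lift f) w) ⟨j, by simp [app, lift, hj, hi]⟩]
  have : d / 4 = d / 2 / 2 := by ring
  rw [this]
  refine hw.trans_eq ?_
  congr 1
  ext u
  simp only [fill_app_lift]
  exact and_iff_right ⟨i, hi⟩

theorem lineFree_averaging {d γ δ θ η : ℝ} (hdγ : 0 ≤ d + γ) {M m s : ℕ}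
    (hM : ∀ S : Set (Fin M → Option β), d + γ ≤ dens S → HasLine S)
    (hη : ∀ g : (Fin s → Option β) → ℝ, (∀ x, g x ≤ 1) ∧ NonposOnSubspaces M g →
      ∀ E : β → Set (Fin s → Option β), (∀ b, Insensitive b (E b)) →
        𝔼 x, ind {x | ∀ b, x ∈ E b}ᶜ x * g x ≤ Fintype.card β * η)
    {ι : Type} [Fintype ι] [DecidableEq ι] {A : Set (Fin m ⊕ ι → Option β)} (hA : ¬ HasLine A)
    (hslice : ∀ p : Fin m → Option β, d - δ ≤ dens {u : ι → Option β | Sum.elim p u ∈ A})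
    {e : Fin m → β ⊕ Fin s} (he : Proper e)
    (hrich : ∀ x, (∃ i, x i = none) →
      θ ≤ dens {u : ι → Option β | ∀ b, Sum.elim (some ∘ fill b (app (lift e) x)) u ∈ A}) :
    d - δ ≤ Fintype.card β * η +
      (d + γ) * (1 - θ * (1 - dens {x : Fin s → Option β | ∀ i, x i ≠ none})) +
      dens {x : Fin s → Option β | ∀ i, x i ≠ none} := by
  classical
  set Z := {x : Fin s → Option β | ∀ i, x i ≠ none}
  let B : (ι → Option β) → Set (Fin s → Option β) := fun u =>
    {x | Sum.elim (app (lift e) x) u ∈ A}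
  let E : (ι → Option β) → β → Set (Fin s → Option β) := fun u b =>
    {x | Sum.elim (some ∘ fill b (app (lift e) x)) u ∈ A}
  let D : (ι → Option β) → Set (Fin s → Option β) := fun u => {x | ∀ b, x ∈ E u b}
  have hE : ∀ u b, Insensitive b (E u b) := by
    intro u b x y hxy
    simp only [E, Set.mem_ofPred_eq, fill_app_congr (lift e) hxy]
  have hg : ∀ u, NonposOnSubspaces M fun x => ind (B u) x - (d + γ) := by
    intro u f hf
    rw [Finset.expect_sub_distrib, Fintype.expect_const]
    by_contra! hcon
    refine hA (HasLine.of_app (proper_sumElim_inr (he.lift.comp hf) u) (hM _ ?_))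
    simp only [app_sumElim_inr, app_comp]
    exact (sub_pos.1 hcon).le
  have hpt : ∀ u x, ind (B u) x ≤
      ind (D u)ᶜ x * (ind (B u) x - (d + γ)) + (d + γ) * ind (D u)ᶜ x + ind Z x := by
    intro u x
    by_cases hD : x ∈ D u
    · rw [ind_of_notMem (A := (D u)ᶜ) (not_not.2 hD)]
      simp only [zero_mul, mul_zero, zero_add]
      by_cases hB : x ∈ B u
      · by_cases hZ : x ∈ Z
        · rw [ind_of_mem hB, ind_of_mem hZ]
        · refine absurd ?_ hA
          obtain ⟨i, hi⟩ : ∃ i, x i = none := by simpa [Z] using hZ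
          refine HasLine.of_app (proper_sumElim_inr (he.lift) u) ?_
          simp only [app_sumElim_inr]
          refine ⟨fun i => (x i).map some, ⟨i, by simp [hi]⟩, fun a => ?_⟩
          cases a with
          | none =>
            have hx : (fun i => ((x i).map some).getD none) = x := by
              funext i
              cases x i <;> rfl
            change Sum.elim (app (lift e) _) u ∈ A
            rw [hx]
            exact hB
          | some b =>
            refine (congrArg (Sum.elim · u ∈ A) ?_).mpr (hD b)
            funext i
            simp only [Function.comp, fill, app, lift]
            rcases e i with a | j
            · rfl
            · simp only [Sum.map_inr, Sum.elim_inr, id]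
              cases x j <;> rfl
      · rw [ind_of_notMem hB]
        exact ind_nonneg _ _
    · rw [ind_of_mem (A := (D u)ᶜ) hD]
      linarith [ind_nonneg Z x]
  have hmeanx : ∀ u, 𝔼 x, ind (B u) x ≤
      Fintype.card β * η + (d + γ) * 𝔼 x, ind (D u)ᶜ x + dens Z := by
    intro u
    refine (Finset.expect_le_expect fun x _ => hpt u x).trans ?_
    rw [Finset.expect_add_distrib, Finset.expect_add_distrib, ← Finset.mul_expect]
    have := hη _ ⟨fun x => by linarith [ind_le_one (B u) x], hg u⟩ (E u) (hE u)
    simp only [dens]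
    linarith
  have hcompl : 𝔼 u, 𝔼 x, ind (D u)ᶜ x ≤ 1 - θ * (1 - dens Z) := by
    rw [Finset.expect_comm]
    have hx : ∀ x, 𝔼 u, ind (D u)ᶜ x ≤ 1 - θ * (1 - ind Z x) := by
      intro x
      by_cases hZ : x ∈ Z
      · rw [ind_of_mem hZ]
        simpa using Finset.expect_le Finset.univ_nonempty fun u _ => ind_le_one (D u)ᶜ x
      · rw [ind_of_notMem hZ]
        have h1 : ∀ u, ind (D u)ᶜ x = 1 - ind {u | x ∈ D u} u := by
          intro u
          by_cases hD : x ∈ D u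
          · rw [ind_of_notMem (not_not.2 hD), ind_of_mem (A := {u | x ∈ D u}) hD, sub_self]
          · rw [ind_of_mem (A := (D u)ᶜ) hD, ind_of_notMem (A := {u | x ∈ D u}) hD, sub_zero]
        simp only [h1, Finset.expect_sub_distrib, Fintype.expect_const]
        have := hrich x (by simpa [Z] using hZ)
        simp only [dens] at this
        simp only [sub_zero, mul_one]
        exact sub_le_sub_left this 1
    refine (Finset.expect_le_expect fun x _ => hx x).trans_eq ?_
    rw [Finset.expect_sub_distrib, ← Finset.mul_expect, Finset.expect_sub_distrib,
      Fintype.expect_const]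
    rfl
  have hlow : d - δ ≤ 𝔼 u, 𝔼 x, ind (B u) x := by
    rw [Finset.expect_comm]
    exact Finset.le_expect Finset.univ_nonempty fun x _ => hslice _
  have := Finset.expect_le_expect (s := Finset.univ) fun u _ => hmeanx u
  rw [Finset.expect_add_distrib, Finset.expect_add_distrib, Fintype.expect_const,
    Fintype.expect_const, ← Finset.mul_expect] at this
  nlinarith [mul_le_mul_of_nonneg_left hcompl hdγ]

theorem exists_dens_forall_ne_none_le {η : ℝ} (hη : 0 < η) :
    ∃ N : ℕ, ∀ s ≥ N, dens {x : Fin s → Option β | ∀ i, x i ≠ none} ≤ η := by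
  classical
  have hcard : (0 : ℝ) < Fintype.card β := by exact_mod_cast Fintype.card_pos
  obtain ⟨N, hN⟩ := exists_pow_le (r := Fintype.card β / (Fintype.card β + 1)) (by positivity)
    ((div_lt_one (by positivity)).2 (by linarith)) 1 hη
  refine ⟨N, fun s hs => (le_of_eq ?_).trans (hN s hs)⟩
  have hprod : ∀ x : Fin s → Option β, ind {x : Fin s → Option β | ∀ i, x i ≠ none} x =
      ∏ i, if x i = none then (0 : ℝ) else 1 := by
    intro x
    by_cases hx : ∀ i, x i ≠ none
    · rw [ind_of_mem (by exact hx)]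
      simp [hx]
    · rw [ind_of_notMem (by exact hx)]
      push Not at hx
      obtain ⟨i, hi⟩ := hx
      exact (Finset.prod_eq_zero (Finset.mem_univ i) (by simp [hi])).symm
  simp only [dens, hprod]
  rw [expect_prod fun a : Option β => if a = none then (0 : ℝ) else 1]
  simp [Fintype.expect_eq_sum_div_card]

/-- The density increment step. -/
theorem exists_dhjAt_sub (hβ : ∀ δ > 0, DHJAt β δ) {d : ℝ} (hd : 0 < d) (hd2 : d ≤ 2)
    (h : ∀ γ > 0, DHJAt (Option β) (d + γ)) : ∃ τ, 0 < τ ∧ τ ≤ d ∧ DHJAt (Option β) (d - τ) := by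
  obtain ⟨N, hN⟩ := hβ (d / 4) (by positivity)
  have hΦ : (1 : ℝ) ≤ Fintype.card (Fin N → Option β) := by exact_mod_cast Fintype.card_pos
  set θ : ℝ := d / 4 / Fintype.card (Fin N → Option β) with hθ
  have hθ0 : 0 < θ := by positivity
  have hθ1 : θ ≤ 1 / 2 := (div_le_self (by positivity) hΦ).trans (by linarith)
  have hdθ : 0 < d * θ / 16 := by positivity
  obtain ⟨M, hM⟩ := h (d * θ / 16) hdθ
  obtain ⟨N₁, h₁⟩ := expect_compl_inter_insensitive_le hβ M
    (show 0 < d * θ / 16 / Fintype.card β from div_pos hdθ (by exact_mod_cast Fintype.card_pos))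
  obtain ⟨N₂, h₂⟩ := exists_dens_forall_ne_none_le (β := β) (η := d * θ / 16) hdθ
  set s := N + N₁ + N₂
  obtain ⟨m, hm⟩ := exists_mono_variableWords β Prop s
  have hP : (1 : ℝ) ≤ Fintype.card (Fin m → Option β) := by exact_mod_cast Fintype.card_pos
  set τ : ℝ := d * θ / 16 / (2 * Fintype.card (Fin m → Option β)) with hτ
  have hτ0 : 0 < τ := by positivity
  have hτP : 2 * Fintype.card (Fin m → Option β) * τ = d * θ / 16 := by
    rw [hτ]
    field_simp
  have hsmall : d * θ ≤ d / 2 := by nlinarith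
  refine ⟨τ, hτ0, by nlinarith, ?_⟩
  obtain ⟨n, hn⟩ := h τ hτ0
  refine ⟨m + n, fun ι _ _ hι S hS => ?_⟩
  obtain ⟨σ⟩ := exists_equiv_sum (show m ≤ Fintype.card ι by omega)
  refine HasLine.of_reindex σ ?_
  rw [dens_arrow_congr σ] at hS
  by_contra hA
  have hslice := le_dens_slice hS fun p => le_of_not_ge fun hp => hA <|
    HasLine.of_app (proper_sumElim_inl p) <| by
      simp only [app_sumElim_inl]
      exact hn _ (by simp; omega) _ hp
  rw [hτP] at hslice
  obtain ⟨e, he, hrich⟩ := exists_rich_subspace hd (hN (Fin N) (by simp))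
    (show N ≤ s by omega) hm _ fun p => (show d / 2 ≤ d - d * θ / 16 by linarith).trans (hslice p)
  have hav := lineFree_averaging (by positivity) (hM (Fin M) (by simp))
    (h₁ (Fin s) (by simp; omega)) hA hslice he hrich
  have hz := h₂ s (by omega)
  set z := dens {x : Fin s → Option β | ∀ i, x i ≠ none}
  have hβ0 : (Fintype.card β : ℝ) ≠ 0 := by exact_mod_cast Fintype.card_ne_zero
  rw [mul_div_cancel₀ _ hβ0] at hav
  have hz1 : z ≤ 1 / 2 := by linarith
  have : (d + d * θ / 16) * (1 - θ * (1 - z)) ≤ (d + d * θ / 16) * (1 - θ / 2) := by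
    refine mul_le_mul_of_nonneg_left ?_ (by positivity)
    nlinarith
  nlinarith [mul_pos hdθ hθ0]

theorem dhjAt_option (hβ : ∀ δ > 0, DHJAt β δ) : ∀ δ > 0, DHJAt (Option β) δ := by
  set T : Set ℝ := {δ | 0 ≤ δ ∧ DHJAt (Option β) δ}
  have h2 : (2 : ℝ) ∈ T := by
    refine ⟨by norm_num, 0, fun ι _ _ _ S hS => ?_⟩
    linarith [dens_le_one S]
  have hbdd : BddBelow T := ⟨0, fun δ hδ => hδ.1⟩
  have habove : ∀ δ, sInf T < δ → DHJAt (Option β) δ := by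
    intro δ hδ
    obtain ⟨δ', hδ', hlt⟩ := exists_lt_of_csInf_lt ⟨2, h2⟩ hδ
    exact hδ'.2.mono hlt.le
  rcases (le_csInf ⟨2, h2⟩ fun δ (hδ : δ ∈ T) => hδ.1).eq_or_lt with h0 | h0
  · rwa [← h0] at habove
  · obtain ⟨τ, hτ, hτd, h⟩ := exists_dhjAt_sub hβ h0 (csInf_le hbdd h2)
      fun γ hγ => habove _ (by linarith)
    have := csInf_le hbdd (show sInf T - τ ∈ T from ⟨by linarith, h⟩)
    linarith

end

theorem dhjAt_of_subsingleton (A : Type) [Fintype A] [Subsingleton A] {δ : ℝ} (hδ : 0 < δ) :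
    DHJAt A δ := by
  refine ⟨1, fun ι _ _ hι S hS => ?_⟩
  obtain ⟨x, hx⟩ := nonempty_of_dens_pos (hδ.trans_le hS)
  obtain ⟨i⟩ := Fintype.card_pos_iff.1 hι
  refine ⟨fun _ => none, ⟨i, rfl⟩, fun a => ?_⟩
  rwa [Subsingleton.elim (fun _ => _) x]

theorem DHJAt.congr {A B : Type} [Fintype A] [Fintype B] (σ : A ≃ B) {δ : ℝ} (h : DHJAt A δ) :
    DHJAt B δ := by
  obtain ⟨N, h⟩ := h
  refine ⟨N, fun ι _ _ hι S hS => ?_⟩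
  have hd : dens {x : ι → A | σ ∘ x ∈ S} = dens S :=
    Fintype.expect_equiv (Equiv.arrowCongr (Equiv.refl ι) σ) _ _ fun x => rfl
  obtain ⟨w, ⟨i, hi⟩, hw⟩ := h ι hι _ (hS.trans_eq hd.symm)
  refine ⟨fun i => (w i).map σ, ⟨i, by simp [hi]⟩, fun b => ?_⟩
  convert show σ ∘ _ ∈ S from hw (σ.symm b) using 1
  funext i
  cases hwi : w i <;> simp [hwi]

/-- The density Hales–Jewett theorem. -/
theorem dhjAt (A : Type) [Finite A] : ∀ [Fintype A], ∀ δ > 0, DHJAt A δ := by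
  induction A using Finite.induction_empty_option with
  | of_equiv σ ih =>
    intro _ δ hδ
    have := Fintype.ofEquiv _ σ.symm
    exact (ih δ hδ).congr σ
  | h_empty => exact fun δ hδ => dhjAt_of_subsingleton _ hδ
  | h_option ih =>
    rename_i β _
    intro inst δ hδ
    obtain rfl := Subsingleton.elim inst instFintypeOption
    rcases isEmpty_or_nonempty β with h | h
    · exact dhjAt_of_subsingleton _ hδ
    · exact dhjAt_option ih δ hδ

/-! ### Affine geometries -/

/-- Dense sets of vectors over a finite field contain affine subspaces. -/
theorem exists_affine_subset (F : Type) [Field F] [Fintype F] (k : ℕ) {δ : ℝ} (hδ : 0 < δ) :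
    ∃ N : ℕ, ∀ n ≥ N, ∀ S : Set (Fin n → F), δ ≤ dens S →
      ∃ (a : Fin n → F) (D : (Fin k → F) →ₗ[F] (Fin n → F)),
        Function.Injective D ∧ ∀ t, a + D t ∈ S := by
  classical
  obtain ⟨K, hK⟩ := dhjAt (Fin k → F) δ hδ
  refine ⟨K * k, fun n hn S hS => ?_⟩
  obtain ⟨σ₀⟩ := exists_equiv_sum (ι := Fin n) (n := K * k) (by simpa using hn)
  let σ := σ₀.trans (Equiv.sumCongr (finProdFinEquiv (m := K) (n := k)).symm (Equiv.refl _))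
  rw [dens_arrow_congr σ, dens_sumArrow] at hS
  obtain ⟨u, -, hu⟩ := Finset.exists_le_of_le_expect Finset.univ_nonempty hS
  let T : Set (Fin K → Fin k → F) :=
    {x | Sum.elim (fun p : Fin K × Fin k => x p.1 p.2) u ∘ σ ∈ S}
  have hT : δ ≤ dens T := hu.trans_eq <|
    Fintype.expect_equiv (Equiv.curry (Fin K) (Fin k) F) _ _ fun x => rfl
  obtain ⟨w, ⟨i, hi⟩, hw⟩ := hK (Fin K) (by simp) T hT
  let D : (Fin k → F) →ₗ[F] (Fin n → F) :=
    { toFun := fun t => Sum.elim (fun p : Fin K × Fin k => if w p.1 = none then t p.2 else 0) 0 ∘ σ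
      map_add' := fun s t => by
        funext j
        simp only [Function.comp, Pi.add_apply]
        rcases σ j with p | j
        · by_cases h : w p.1 = none <;> simp [h]
        · simp
      map_smul' := fun c t => by
        funext j
        simp only [Function.comp, Pi.smul_apply, RingHom.id_apply]
        rcases σ j with p | j <;> simp }
  refine ⟨Sum.elim (fun p : Fin K × Fin k => (w p.1).getD 0 p.2) u ∘ σ, D, ?_, fun t => ?_⟩
  · intro s t hst
    funext j
    simpa [D, hi] using congrFun hst (σ.symm (Sum.inl (i, j)))
  · have h := hw t
    convert (show Sum.elim (fun p : Fin K × Fin k => (w p.1).getD t p.2) u ∘ σ ∈ S from h) using 1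
    funext j
    simp only [D, LinearMap.coe_mk, AddHom.coe_mk, Function.comp, Pi.add_apply]
    rcases σ j with p | j
    · cases hp : w p.1 <;> simp [hp]
    · simp

/-- The nonzero vectors spanning a point of `M`. -/
def cone {F : Type} [Field F] {n : ℕ} (M : Set (Projectivization F (Fin n → F))) :
    Set (Fin n → F) :=
  {v | ∃ hv : v ≠ 0, Projectivization.mk F v hv ∈ M}

theorem smul_mem_cone {F : Type} [Field F] {n : ℕ} {M : Set (Projectivization F (Fin n → F))}
    {c : F} (hc : c ≠ 0) {v : Fin n → F} (hv : v ∈ cone M) : c • v ∈ cone M := by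
  obtain ⟨hv0, hv⟩ := hv
  refine ⟨smul_ne_zero hc hv0, ?_⟩
  convert hv using 1
  exact (Projectivization.mk_eq_mk_iff' F _ _ _ _).2 ⟨c, rfl⟩

theorem le_ncard_cone {F : Type} [Field F] [Fintype F] {n : ℕ}
    (M : Set (Projectivization F (Fin n → F))) :
    M.ncard * (Fintype.card F - 1) ≤ (cone M).ncard := by
  classical
  have hmem : ∀ p : M × Fˣ, ((p.2 : F) • p.1.1.rep) ∈ cone M := fun p =>
    smul_mem_cone p.2.ne_zero
      ⟨p.1.1.rep_nonzero, by simpa only [Projectivization.mk_rep] using p.1.2⟩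
  have hmk : ∀ p : M × Fˣ, Projectivization.mk F ((p.2 : F) • p.1.1.rep) (hmem p).1 = p.1.1 :=
    fun p => by
      conv_rhs => rw [← p.1.1.mk_rep]
      exact (Projectivization.mk_eq_mk_iff' F _ _ _ _).2 ⟨p.2, rfl⟩
  have hinj : Function.Injective fun p : M × Fˣ =>
      (⟨(p.2 : F) • p.1.1.rep, hmem p⟩ : cone M) := by
    rintro ⟨x, c⟩ ⟨y, d⟩ h
    have hv : (c : F) • x.1.rep = (d : F) • y.1.rep := congrArg Subtype.val h
    have hxy : x = y := by
      apply Subtype.ext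
      rw [← hmk (x, c), ← hmk (y, d)]
      simp only [hv]
    subst hxy
    have := smul_left_injective F x.1.rep_nonzero hv
    rw [Units.ext this]
  have := Nat.card_le_card_of_injective _ hinj
  rwa [Nat.card_prod, Nat.card_eq_fintype_card (α := Fˣ), Fintype.card_units] at this

theorem pgContains_of_affine_subset {F : Type} [Field F] {k n : ℕ}
    {M : Set (Projectivization F (Fin n → F))} {a : Fin n → F}
    {D : (Fin k → F) →ₗ[F] (Fin n → F)} (hD : Function.Injective D)
    (h : ∀ t, a + D t ∈ cone M) : PGContains F (k + 1) n (pgDel F (k + 1) 1) M := by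
  let f : (Fin (k + 1) → F) →ₗ[F] (Fin n → F) :=
    (LinearMap.proj (Fin.last k)).smulRight a + D ∘ₗ LinearMap.funLeft F F Fin.castSucc
  have hf : ∀ v, v (Fin.last k) ≠ 0 → f v ∈ cone M := by
    intro v hv
    have := smul_mem_cone hv (h ((v (Fin.last k))⁻¹ • LinearMap.funLeft F F Fin.castSucc v))
    rwa [smul_add, ← map_smul, smul_inv_smul₀ hv] at this
  have hinj : Function.Injective f := by
    rw [← LinearMap.ker_eq_bot, LinearMap.ker_eq_bot']
    intro v hv
    have hlast : v (Fin.last k) = 0 := by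
      by_contra hne
      exact (hf v hne).1 hv
    have hDv : D (LinearMap.funLeft F F Fin.castSucc v) = 0 := by simpa [f, hlast] using hv
    have h0 := (map_eq_zero_iff D hD).1 hDv
    funext i
    refine Fin.lastCases hlast (fun j => ?_) i
    exact congrFun h0 j
  refine ⟨f, hinj, fun x hx => ?_⟩
  induction x using Projectivization.ind with
  | h v hv =>
    rw [Projectivization.map_mk]
    refine (hf v fun hlast => hx ?_).2
    rw [Projectivization.submodule_mk, Submodule.span_singleton_le_iff_mem, stdSubspace,
      LinearMap.mem_ker]
    funext ⟨i, hi⟩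
    have : i = Fin.last k := le_antisymm (Fin.le_last i) hi
    subst this
    exact hlast

theorem exists_pgContains (F : Type) [Field F] [Fintype F] (k : ℕ) {ε : ℝ} (hε : 0 < ε) :
    ∃ N : ℕ, ∀ n > N, ∀ M : Set (Projectivization F (Fin n → F)),
      ε * (((Fintype.card F : ℝ) ^ n - 1) / ((Fintype.card F : ℝ) - 1)) ≤ M.ncard →
      PGContains F (k + 1) n (pgDel F (k + 1) 1) M := by
  obtain ⟨N, hN⟩ := exists_affine_subset F k (half_pos hε)
  refine ⟨N, fun n hn M hM => ?_⟩
  have hq : 1 < Fintype.card F := Fintype.one_lt_card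
  have hq' : (2 : ℝ) ≤ Fintype.card F := by exact_mod_cast hq
  have hpow : (2 : ℝ) ≤ (Fintype.card F : ℝ) ^ n :=
    hq'.trans (le_self_pow₀ (by linarith) (by omega))
  have hcone : (M.ncard : ℝ) * (Fintype.card F - 1) ≤ (cone M).ncard := by
    have := le_ncard_cone M
    have : ((M.ncard * (Fintype.card F - 1) : ℕ) : ℝ) ≤ (cone M).ncard := by exact_mod_cast this
    rwa [Nat.cast_mul, Nat.cast_sub hq.le, Nat.cast_one] at this
  rw [mul_div_assoc', div_le_iff₀ (by linarith)] at hM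
  have hdens : ε / 2 ≤ dens (cone M) := by
    rw [dens_eq_ncard_div, Fintype.card_fun, Fintype.card_fin, Nat.cast_pow,
      le_div_iff₀ (by linarith)]
    nlinarith
  obtain ⟨a, D, hD, h⟩ := hN n hn.le (cone M) hdens
  exact pgContains_of_affine_subset hD h

end DensityHalesJewett

/-- **Density Hales–Jewett for geometries** (Furstenberg–Katznelson): for each prime power
`q = |F|`, integer `m ≥ 2`, and real `ε > 0`, there is `R` such that
`ex_q(AG(m-1,q); n) < ε (q^n - 1)/(q - 1)` for all `n > R`. -/
theorem affine_geometry_density (F : Type) [Field F] [Fintype F]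
    (m : ℕ) (hm : 2 ≤ m) (ε : ℝ) (hε : 0 < ε) :
    ∃ R : ℕ, ∀ n : ℕ, R < n →
      (pgEx F m (pgDel F m 1) n : ℝ) <
        ε * (((Fintype.card F : ℝ) ^ n - 1) / ((Fintype.card F : ℝ) - 1)) := by
  obtain ⟨k, rfl⟩ : ∃ k, m = k + 1 := ⟨m - 1, by omega⟩
  obtain ⟨N, hN⟩ := DensityHalesJewett.exists_pgContains F k hε
  refine ⟨N, fun n hn => ?_⟩
  set T := {l | ∃ M : Set (Projectivization F (Fin n → F)),
    ¬ PGContains F (k + 1) n (pgDel F (k + 1) 1) M ∧ M.ncard = l}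
  change ((sSup T : ℕ) : ℝ) < _
  rcases T.eq_empty_or_nonempty with hT | hT
  · rw [hT, csSup_empty, Nat.bot_eq_zero, Nat.cast_zero]
    have hq : (1 : ℝ) < Fintype.card F := by exact_mod_cast Fintype.one_lt_card
    have := one_lt_pow₀ hq (show n ≠ 0 by omega)
    exact mul_pos hε (div_pos (by linarith) (by linarith))
  · have hbdd : BddAbove T := by
      refine ⟨Nat.card (Projectivization F (Fin n → F)), ?_⟩
      rintro _ ⟨M, -, rfl⟩
      exact Set.ncard_le_card M
    obtain ⟨M, hM, hcard⟩ := Nat.sSup_mem hT hbdd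
    rw [← hcard]
    by_contra! hcon
    exact hM (hN n hn M hcon)
end

section
/- For any finite simple graph H with chromatic number χ ≥ 2, the limit as n → ∞ of ex(H; n) / (n choose 2) exists and equals 1 - 1/(χ - 1). -/
/-- `ex(H; n)`: the maximum number of edges of a simple graph on `n` vertices containing
no subgraph isomorphic to `H`. -/
noncomputable def graphEx {α : Type} (H : SimpleGraph α) (n : ℕ) : ℕ :=
  sSup {k | ∃ G : SimpleGraph (Fin n),
    (¬ ∃ f : H →g G, Function.Injective f) ∧ G.edgeSet.ncard = k}

open Filter Finset SimpleGraph

theorem free_iff_not_exists_injective_hom {V W : Type*} {G : SimpleGraph V} {H : SimpleGraph W} :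
    H.Free G ↔ ¬ ∃ f : H →g G, Function.Injective f :=
  not_congr ⟨fun ⟨f⟩ => ⟨f.toHom, f.injective⟩, fun ⟨f, hf⟩ => ⟨⟨f, hf⟩⟩⟩

theorem graphEx_eq_extremalNumber {α : Type} (H : SimpleGraph α) (n : ℕ) :
    graphEx H n = extremalNumber n H := by
  classical
  have hub : ∀ k ∈ {k | ∃ G : SimpleGraph (Fin n),
      (¬ ∃ f : H →g G, Function.Injective f) ∧ G.edgeSet.ncard = k}, k ≤ extremalNumber n H := by
    rintro k ⟨G, hG, rfl⟩
    rw [← coe_edgeFinset, Set.ncard_coe_finset]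
    simpa using card_edgeFinset_le_extremalNumber (free_iff_not_exists_injective_hom.2 hG)
  refine le_antisymm (csSup_le' hub) ?_
  have h := extremalNumber_le_iff (V := Fin n) H (graphEx H n)
  rw [Fintype.card_fin] at h
  refine h.2 fun G _ hG => le_csSup ⟨_, hub⟩ ⟨G, free_iff_not_exists_injective_hom.1 hG, ?_⟩
  rw [← coe_edgeFinset, Set.ncard_coe_finset]

/-- The Turán graph has at least the average number of edges of a random `r`-partite graph. -/
theorem mul_choose_two_le_card_edgeFinset_turanGraph {r : ℕ} (hr : 0 < r) (n : ℕ) :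
    (r - 1) * n.choose 2 ≤ r * #(turanGraph n r).edgeFinset := by
  induction n using Nat.strong_induction_on with
  | _ n ih =>
    rcases le_or_gt n r with h | h
    · have hc : #(turanGraph n r).edgeFinset = n.choose 2 := by
        have := card_edgeFinset_top_eq_card_choose_two (V := Fin n)
        rw [Fintype.card_fin] at this
        convert! this
        exact turanGraph_eq_top.2 (.inr h)
      rw [hc]
      gcongr
      exact Nat.sub_le r 1
    · obtain ⟨m, rfl⟩ := Nat.exists_eq_add_of_le' h.le
      have hm := ih m (by omega)
      have hch : (m + r).choose 2 = m.choose 2 + m * r + r.choose 2 := by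
        rw [Nat.add_choose_eq]
        simp [Finset.Nat.antidiagonal_succ]
        ring
      rw [card_edgeFinset_turanGraph_add, hch]
      have : (r - 1) * r.choose 2 ≤ r * r.choose 2 := by
        gcongr
        exact Nat.sub_le r 1
      linarith [mul_left_comm r m (r - 1)]

theorem turanGraph_colorable {r : ℕ} (hr : 0 < r) (n : ℕ) : (turanGraph n r).Colorable r :=
  ⟨Coloring.mk (fun v => ⟨v % r, Nat.mod_lt _ hr⟩) fun {v w} h => by
    simpa [Fin.ext_iff] using turanGraph_adj.1 h⟩

theorem one_sub_inv_le_extremalNumber_div_choose_two {W : Type*} {H : SimpleGraph W} {r : ℕ}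
    (hr : 0 < r) (hH : ¬ H.Colorable r) {n : ℕ} (hn : 2 ≤ n) :
    1 - 1 / (r : ℝ) ≤ extremalNumber n H / (n.choose 2 : ℝ) := by
  have hfree : H.Free (turanGraph n r) := fun ⟨f⟩ =>
    hH ((turanGraph_colorable hr n).of_hom f.toHom)
  have h1 := card_edgeFinset_le_extremalNumber hfree
  rw [Fintype.card_fin] at h1
  have h2 := (mul_choose_two_le_card_edgeFinset_turanGraph hr n).trans
    (Nat.mul_le_mul_left r h1)
  have hr' : (0 : ℝ) < r := by exact_mod_cast hr
  have h3 : ((r : ℝ) - 1) * n.choose 2 ≤ r * extremalNumber n H := by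
    rw [← Nat.cast_pred hr]
    exact_mod_cast h2
  rw [le_div_iff₀ (mod_cast Nat.choose_pos hn), one_sub_div hr'.ne', div_mul_eq_mul_div,
    div_le_iff₀' hr']
  exact h3

/-- The minimum-degree version of the Erdős–Stone theorem for general graphs. -/
theorem eventually_isContained_of_minDegree {W : Type*} [Fintype W] {H : SimpleGraph W} {r : ℕ}
    (hH : H.Colorable (r + 1)) {ε : ℝ} (hε : 0 < ε) :
    ∀ᶠ n in atTop, ∀ {G : SimpleGraph (Fin n)} [DecidableRel G.Adj],
      G.minDegree ≥ (1 - 1 / r + ε) * n → H ⊑ G := by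
  classical
  filter_upwards [eventually_completeEquipartiteGraph_isContained_of_minDegree hε r
    (Fintype.card W)] with n hn G _ hG
  obtain ⟨C⟩ := hH
  exact (isContained_completeEquipartiteGraph_of_colorable C _
    fun c => Fintype.card_subtype_le _).trans (hn hG)

theorem eventually_extremalNumber_succ_le {W : Type*} [Fintype W] {H : SimpleGraph W} {r : ℕ}
    (hH : H.Colorable (r + 1)) {ε : ℝ} (hε : 0 < ε) (hr : 0 < r) :
    ∀ᶠ n : ℕ in atTop, (extremalNumber (n + 1) H : ℝ) ≤
      extremalNumber n H + (1 - 1 / r + ε) * (n + 1 : ℕ) := by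
  classical
  filter_upwards [(tendsto_add_atTop_nat 1).eventually
    (eventually_isContained_of_minDegree hH hε)] with n hn
  have hr' : (1 : ℝ) / r ≤ 1 := by
    rw [div_le_one (by exact_mod_cast hr)]
    exact_mod_cast hr
  have hc : 0 ≤ 1 - 1 / (r : ℝ) + ε := by linarith
  have key := extremalNumber_le_iff_of_nonneg (V := Fin (n + 1)) (R := ℝ) H
    (m := extremalNumber n H + (1 - 1 / r + ε) * (n + 1 : ℕ)) (by positivity)
  rw [Fintype.card_fin] at key
  refine key.2 fun G _ hG => ?_
  have hdeg : (G.minDegree : ℝ) < (1 - 1 / r + ε) * (n + 1 : ℕ) := by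
    by_contra! h
    exact hG (hn h)
  obtain ⟨v, hv⟩ := G.exists_minimal_degree_vertex
  have h1 := card_edgeFinset_deleteIncidenceSet_le_extremalNumber hG v
  rw [card_edgeFinset_deleteIncidenceSet, Fintype.card_fin, Nat.add_sub_cancel, ← hv,
    Nat.sub_le_iff_le_add] at h1
  have h2 : (#G.edgeFinset : ℝ) ≤ extremalNumber n H + G.minDegree := by exact_mod_cast h1
  linarith

/-- A sequence whose increments are eventually at most `c * n` grows at most like
`c * n.choose 2`. -/
theorem le_of_tendsto_div_choose_two_of_eventually_succ_le {u : ℕ → ℝ} {c l : ℝ}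
    (hu : ∀ᶠ n : ℕ in atTop, u (n + 1) ≤ u n + c * (n + 1 : ℕ))
    (hl : Tendsto (fun n => u n / (n.choose 2 : ℝ)) atTop (nhds l)) : l ≤ c := by
  obtain ⟨N, hN⟩ := eventually_atTop.1 hu
  set K : ℝ := u N - c * (N + 1).choose 2 with hK
  have hbound : ∀ n ≥ N, u n ≤ K + c * ((n + 1).choose 2 : ℕ) := by
    intro n hn
    induction n, hn using Nat.le_induction with
    | base => simp [hK]
    | succ n hn ih =>
      have h := hN n hn
      have hs : (n + 1 + 1).choose 2 = (n + 1) + (n + 1).choose 2 := by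
        rw [Nat.choose_succ_succ' (n + 1) 1, Nat.choose_one_right]
      rw [hs]
      push_cast at h ih ⊢
      linarith
  have hchoose : Tendsto (fun n : ℕ => (n.choose 2 : ℝ)) atTop atTop := by
    refine tendsto_natCast_atTop_atTop.comp ?_
    refine tendsto_atTop_mono' _ ?_ (tendsto_sub_atTop_nat 1)
    filter_upwards [eventually_ge_atTop 2] with n hn
    rw [Nat.choose_two_right, Nat.le_div_iff_mul_le two_pos, mul_comm]
    gcongr
  have hlim : Tendsto (fun n : ℕ => K / (n.choose 2 : ℝ) + c * (1 + 2 / ((n : ℝ) - 1)))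
      atTop (nhds (0 + c * (1 + 0))) := by
    refine (hchoose.const_div_atTop K).add ((tendsto_const_nhds.add ?_).const_mul c)
    exact (tendsto_atTop_add_const_right _ (-1) tendsto_natCast_atTop_atTop).const_div_atTop 2
  rw [zero_add, add_zero, mul_one] at hlim
  refine le_of_tendsto_of_tendsto hl hlim ?_
  filter_upwards [eventually_ge_atTop N, eventually_ge_atTop 2] with n hn hn2
  have hpos : (0 : ℝ) < n.choose 2 := by exact_mod_cast Nat.choose_pos hn2
  have hn1 : (0 : ℝ) < (n : ℝ) - 1 := by
    have : (2 : ℝ) ≤ n := by exact_mod_cast hn2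
    linarith
  have h := hbound n hn
  have hs : (((n + 1).choose 2 : ℕ) : ℝ) = n.choose 2 * (1 + 2 / ((n : ℝ) - 1)) := by
    rw [Nat.cast_choose_two, Nat.cast_choose_two]
    push_cast
    field_simp
    ring
  rw [div_le_iff₀ hpos, add_mul, div_mul_cancel₀ _ hpos.ne']
  rw [hs] at h
  linarith

/-- The Turán density of a graph of chromatic number `r + 1` is `1 - 1 / r`. -/
theorem turanDensity_eq_one_sub_inv {W : Type*} [Fintype W] {H : SimpleGraph W} {r : ℕ}
    (hr : 0 < r) (hcol : H.Colorable (r + 1)) (hncol : ¬ H.Colorable r) :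
    turanDensity H = 1 - 1 / (r : ℝ) := by
  refine le_antisymm (le_of_forall_pos_le_add fun ε hε => ?_) ?_
  · exact le_of_tendsto_div_choose_two_of_eventually_succ_le
      (eventually_extremalNumber_succ_le hcol hε hr) (tendsto_turanDensity H)
  · refine ge_of_tendsto (tendsto_turanDensity H) ?_
    filter_upwards [eventually_ge_atTop 2] with n hn
    exact one_sub_inv_le_extremalNumber_div_choose_two hr hncol hn

/-- **Erdős–Stone theorem.** For any finite simple graph `H` with chromatic number
`χ ≥ 2`, `ex(H; n) / (n choose 2) → 1 - 1/(χ - 1)` as `n → ∞`. -/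
theorem erdos_stone {α : Type} [Fintype α] (H : SimpleGraph α)
    (χ : ℕ) (hχ : 2 ≤ χ) (hchrom : H.chromaticNumber = (χ : ℕ∞)) :
    Filter.Tendsto (fun n : ℕ => (graphEx H n : ℝ) / (n.choose 2 : ℝ))
      Filter.atTop (nhds (1 - 1 / ((χ : ℝ) - 1))) := by
  obtain ⟨r, rfl⟩ := Nat.exists_eq_add_of_le' (one_le_two.trans hχ)
  have hcol : H.Colorable (r + 1) := chromaticNumber_le_iff_colorable.1 hchrom.le
  have hncol : ¬ H.Colorable r := fun h => by
    have := chromaticNumber_le_iff_colorable.2 h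
    rw [hchrom, Nat.cast_le] at this
    omega
  simp_rw [graphEx_eq_extremalNumber]
  rw [Nat.cast_add_one, add_sub_cancel_right,
    ← turanDensity_eq_one_sub_inv (by omega) hcol hncol]
  exact tendsto_turanDensity H
end

section
/- For all integers m > c ≥ 1 and every real number ε with 0 < ε ≤ 1, if d = ⌈log₂⌈2 - log₂ ε⌉⌉ and n > T_c(m+d), then ex_2(G(m-1,2,c); n) < (1 - 2^{1-c} + ε)·(2^n - 1), where T_0(s) = s and T_i(s) = T_{i-1}(2^s) for all i > 0. -/
/-- The tower function: `T 0 s = s` and `T (i+1) s = T i (2^s)`. -/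
def tower : ℕ → ℕ → ℕ
  | 0, s => s
  | i + 1, s => tower i (2 ^ s)

open Finset Module

/-- A sufficiently dense subset of a binary vector space, invariant under translation by a
subspace `U`, contains a translate of a subspace of dimension `r + finrank U`. -/
theorem exists_translate_subset_of_invariant {V : Type*} [AddCommGroup V] [Module (ZMod 2) V]
    [Fintype V] (r : ℕ) : ∀ (t : ℕ) (U : Submodule (ZMod 2) V) (A : Finset V),
    (∀ a ∈ A, ∀ u ∈ U, a + u ∈ A) →
    2 ^ finrank (ZMod 2) V ≤ #A * 2 ^ t →
    2 ^ r * (t + 1) + r + finrank (ZMod 2) U ≤ finrank (ZMod 2) V →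
    ∃ (U' : Submodule (ZMod 2) V) (a : V),
      finrank (ZMod 2) U' = r + finrank (ZMod 2) U ∧ ∀ u ∈ U', a + u ∈ A := by
  classical
  induction r with
  | zero =>
    intro t U A hinv hcard _
    have hA : A.Nonempty := by
      rw [Finset.nonempty_iff_ne_empty]
      rintro rfl
      simp at hcard
    obtain ⟨a, ha⟩ := hA
    exact ⟨U, a, by simp, hinv a ha⟩
  | succ r ih =>
    intro t U A hinv hcard hdim
    set k := finrank (ZMod 2) V with hk
    set i := finrank (ZMod 2) U with hi
    have hVcard : Fintype.card V = 2 ^ k := by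
      rw [Module.card_eq_pow_finrank (K := ZMod 2), ZMod.card]
    have hUcard : #{u : V | u ∈ U} = 2 ^ i := by
      rw [← Fintype.card_subtype]
      have := Module.card_eq_pow_finrank (K := ZMod 2) (V := U)
      rw [ZMod.card] at this
      convert this
    have hpow : 2 ^ (i + 1) ≤ #A := by
      have h1 : i + 1 + t ≤ k := by
        have : t + 1 ≤ 2 ^ (r + 1) * (t + 1) := Nat.le_mul_of_pos_left _ (by positivity)
        omega
      have h2 : 2 ^ (i + 1) * 2 ^ t ≤ #A * 2 ^ t := by
        rw [← pow_add]
        exact (Nat.pow_le_pow_right (by norm_num) h1).trans hcard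
      exact Nat.le_of_mul_le_mul_right h2 (by positivity)
    have hsum : ∑ s : V, #{a ∈ A | a + s ∈ A} = #A * #A := by
      simp_rw [Finset.card_filter]
      rw [Finset.sum_comm, ← smul_eq_mul, ← Finset.sum_const]
      refine Finset.sum_congr rfl fun a _ => ?_
      rw [← Finset.card_filter]
      refine Finset.card_bij (fun s _ => a + s) (by simp) (by simp) ?_
      intro b hb
      exact ⟨b - a, by simpa using hb, by simp⟩
    have hsplit := Finset.sum_filter_add_sum_filter_not (univ : Finset V) (fun s => s ∈ U)
      (fun s => #{a ∈ A | a + s ∈ A})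
    have hUpart : ∑ s ∈ {s : V | s ∈ U}, #{a ∈ A | a + s ∈ A} ≤ 2 ^ i * #A := by
      rw [← hUcard, ← smul_eq_mul]
      exact Finset.sum_le_card_nsmul _ _ _ fun s _ => Finset.card_filter_le _ _
    obtain ⟨s, hsU, hs⟩ : ∃ s ∉ U, #A * #A ≤ #{a ∈ A | a + s ∈ A} * 2 ^ (k + 1) := by
      by_contra! hcon
      have h1 : (∑ s ∈ {s : V | s ∉ U}, #{a ∈ A | a + s ∈ A}) * 2 ^ (k + 1) ≤
          (2 ^ k - 1) * (#A * #A) := by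
        rw [Finset.sum_mul]
        have h2 : #{s : V | s ∉ U} ≤ 2 ^ k - 1 := by
          have := Finset.card_filter_add_card_filter_not (s := (univ : Finset V)) (fun s => s ∈ U)
          rw [Finset.card_univ, hVcard, hUcard] at this
          have : 0 < 2 ^ i := by positivity
          omega
        refine le_trans (Finset.sum_le_card_nsmul _ _ (#A * #A) fun s hs => ?_) ?_
        · exact (hcon s (by simpa using hs)).le
        · rw [smul_eq_mul]
          gcongr
      have h3 : 2 ^ i * 2 ≤ #A := by rwa [pow_succ] at hpow
      have hA : 0 < #A := lt_of_lt_of_le (by positivity) h3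
      have hk0 : 0 < 2 ^ k := by positivity
      obtain ⟨K, hK⟩ : ∃ K, 2 ^ k = K + 1 := ⟨2 ^ k - 1, by omega⟩
      rw [pow_succ, hK] at h1
      simp only [Nat.add_sub_cancel] at h1
      rw [hsum] at hsplit
      nlinarith [Nat.mul_le_mul_right (#A) h3]
    have hss : s + s = 0 := by
      rw [← two_smul (ZMod 2) s, show (2 : ZMod 2) = 0 from rfl, zero_smul]
    have hscal : ∀ c : ZMod 2, c = 0 ∨ c = 1 := by decide
    have hrank : finrank (ZMod 2) ↥(U ⊔ Submodule.span (ZMod 2) {s}) = i + 1 := by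
      have hs0 : s ≠ 0 := fun h => hsU (h ▸ U.zero_mem)
      have hd : Disjoint U (Submodule.span (ZMod 2) {s}) :=
        (Submodule.disjoint_span_singleton' hs0).2 hsU
      have := Submodule.finrank_sup_add_finrank_inf_eq U (Submodule.span (ZMod 2) {s})
      rw [hd.eq_bot, finrank_bot, finrank_span_singleton hs0] at this
      omega
    obtain ⟨U', a, hU', ha⟩ := ih (2 * t + 1) (U ⊔ Submodule.span (ZMod 2) {s})
      {a ∈ A | a + s ∈ A} (by
        intro a ha u hu
        obtain ⟨u', hu', w, hw, rfl⟩ := Submodule.mem_sup.1 hu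
        obtain ⟨c, rfl⟩ := Submodule.mem_span_singleton.1 hw
        simp only [Finset.mem_filter] at ha ⊢
        rcases hscal c with rfl | rfl
        · refine ⟨by simpa using hinv a ha.1 u' hu', ?_⟩
          have := hinv _ ha.2 u' hu'
          rwa [zero_smul, add_zero, add_right_comm]
        · refine ⟨?_, ?_⟩
          · have := hinv _ ha.2 u' hu'
            rwa [one_smul, ← add_assoc, add_right_comm]
          · have := hinv _ ha.1 u' hu'
            rwa [one_smul, add_assoc, add_assoc, hss, add_zero])
      (by
        have h1 : 2 ^ k * 2 ^ k ≤ (#A * 2 ^ t) * (#A * 2 ^ t) := Nat.mul_le_mul hcard hcard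
        have h2 : 2 ^ k * 2 ^ k ≤ 2 ^ k * (#{a ∈ A | a + s ∈ A} * 2 ^ (2 * t + 1)) := by
          calc _ ≤ _ := h1
            _ = (#A * #A) * 2 ^ (2 * t) := by ring
            _ ≤ _ := Nat.mul_le_mul_right _ hs
            _ = _ := by ring
        exact Nat.le_of_mul_le_mul_left h2 (by positivity))
      (by rw [hrank]; ring_nf at hdim ⊢; omega)
    exact ⟨U', a, by rw [hU', hrank]; omega, fun u hu => (Finset.mem_filter.1 (ha u hu)).1⟩

/-- A sufficiently dense subset of a binary vector space contains an affine subspace of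
dimension `r`. -/
theorem exists_affine_subset {V : Type*} [AddCommGroup V] [Module (ZMod 2) V]
    [Fintype V] (r t : ℕ) (A : Finset V)
    (hA : 2 ^ finrank (ZMod 2) V ≤ #A * 2 ^ t)
    (hr : 2 ^ r * (t + 1) + r ≤ finrank (ZMod 2) V) :
    ∃ (U : Submodule (ZMod 2) V) (a : V),
      finrank (ZMod 2) U = r ∧ ∀ u ∈ U, a + u ∈ A := by
  obtain ⟨U, a, hU, ha⟩ := exists_translate_subset_of_invariant r t (⊥ : Submodule (ZMod 2) V) A
    (by intro a ha u hu; simpa [(Submodule.mem_bot _).1 hu] using ha) hA (by simpa using hr)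
  exact ⟨U, a, by simpa using hU, ha⟩

/-- A sufficiently dense subset of a binary vector space contains a translate of a subspace
of dimension `r` of any sufficiently large prescribed subspace `V`. -/
theorem exists_translate_subset_of_le {E : Type*} [AddCommGroup E] [Module (ZMod 2) E]
    [Fintype E] (V : Submodule (ZMod 2) E) (r t : ℕ) (A : Finset E)
    (hA : 2 ^ finrank (ZMod 2) E ≤ #A * 2 ^ t)
    (hr : 2 ^ r * (t + 1) + r ≤ finrank (ZMod 2) V) :
    ∃ U ≤ V, ∃ a : E, finrank (ZMod 2) U = r ∧ ∀ u ∈ U, a + u ∈ A := by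
  classical
  have hEcard : Fintype.card E = 2 ^ finrank (ZMod 2) E := by
    rw [Module.card_eq_pow_finrank (K := ZMod 2), ZMod.card]
  have hVcard : Fintype.card V = 2 ^ finrank (ZMod 2) V := by
    rw [Module.card_eq_pow_finrank (K := ZMod 2), ZMod.card]
  have hsum : ∑ x : E, #{v : V | x + v ∈ A} = 2 ^ finrank (ZMod 2) V * #A := by
    simp_rw [Finset.card_filter]
    rw [Finset.sum_comm, ← hVcard, ← Finset.card_univ, ← smul_eq_mul, ← Finset.sum_const]
    refine Finset.sum_congr rfl fun v _ => ?_
    rw [← Finset.card_filter]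
    refine Finset.card_bij (fun x _ => x + (v : E)) (by simp) (by simp) ?_
    intro b hb
    exact ⟨b - v, by simpa using hb, by simp⟩
  obtain ⟨x, hx⟩ : ∃ x : E, 2 ^ finrank (ZMod 2) V * #A ≤
      2 ^ finrank (ZMod 2) E * #{v : V | x + v ∈ A} := by
    by_contra! hcon
    have := Finset.sum_lt_sum_of_nonempty (s := (univ : Finset E)) univ_nonempty
      fun x _ => hcon x
    rw [← Finset.mul_sum, hsum, Finset.sum_const, Finset.card_univ, hEcard, smul_eq_mul] at this
    exact lt_irrefl _ this
  obtain ⟨U, a, hU, ha⟩ := exists_affine_subset r t {v : V | x + v ∈ A} (by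
    have h : 2 ^ finrank (ZMod 2) E * 2 ^ finrank (ZMod 2) V ≤
        2 ^ finrank (ZMod 2) E * (#{v : V | x + v ∈ A} * 2 ^ t) := by
      calc _ ≤ #A * 2 ^ t * 2 ^ finrank (ZMod 2) V := Nat.mul_le_mul_right _ hA
        _ = 2 ^ finrank (ZMod 2) V * #A * 2 ^ t := by ring
        _ ≤ _ := Nat.mul_le_mul_right _ hx
        _ = _ := by ring
    exact Nat.le_of_mul_le_mul_left h (by positivity)) hr
  refine ⟨U.map V.subtype, Submodule.map_subtype_le V U, x + a, ?_, ?_⟩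
  · rw [Submodule.finrank_map_subtype_eq, hU]
  · rintro _ ⟨u, hu, rfl⟩
    have := ha u hu
    simpa [add_assoc] using this

/-- If every point of `V ⊔ C` outside `V` lies in `M` and few vectors are outside `M`, then
`V` has a subspace `U` of dimension `r` and `C` extends to `C'` of one larger dimension
such that every point of `U ⊔ C'` outside `U` lies in `M`. -/
theorem exists_extension {E : Type*} [AddCommGroup E] [Module (ZMod 2) E] [Fintype E]
    (M : Finset E) (V C : Submodule (ZMod 2) E) (hVC : Disjoint V C)
    (hM : ∀ v ∈ V, ∀ w ∈ C, w ≠ 0 → v + w ∈ M) (r t b : ℕ)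
    (hb : ∀ B : Finset E, 0 ∉ B → Disjoint B M → #B ≤ b)
    (hcount : 2 ^ finrank (ZMod 2) E + (2 ^ (finrank (ZMod 2) V + finrank (ZMod 2) C) +
      2 ^ finrank (ZMod 2) C * b) * 2 ^ t ≤ 2 ^ finrank (ZMod 2) E * 2 ^ t)
    (hr : 2 ^ r * (t + 1) + r ≤ finrank (ZMod 2) V) :
    ∃ U C' : Submodule (ZMod 2) E, Disjoint U C' ∧ finrank (ZMod 2) U = r ∧
      finrank (ZMod 2) C' = finrank (ZMod 2) C + 1 ∧
      ∀ v ∈ U, ∀ w ∈ C', w ≠ 0 → v + w ∈ M := by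
  classical
  have hscal : ∀ c : ZMod 2, c = 0 ∨ c = 1 := by decide
  have hcard (X : Submodule (ZMod 2) E) : #{x : E | x ∈ X} = 2 ^ finrank (ZMod 2) X := by
    rw [← Fintype.card_subtype]
    have := Module.card_eq_pow_finrank (K := ZMod 2) (V := X)
    rw [ZMod.card] at this
    convert this
  have hEcard : Fintype.card E = 2 ^ finrank (ZMod 2) E := by
    rw [Module.card_eq_pow_finrank (K := ZMod 2), ZMod.card]
  have hsup : finrank (ZMod 2) ↥(V ⊔ C) = finrank (ZMod 2) V + finrank (ZMod 2) C := by
    have := Submodule.finrank_sup_add_finrank_inf_eq V C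
    rwa [hVC.eq_bot, finrank_bot, add_zero] at this
  set A : Finset E := {x : E | x ∉ V ⊔ C ∧ ∀ c ∈ C, x + c ∈ M} with hA
  set B : Finset E := {x : E | x ∉ V ⊔ C ∧ x ∉ M} with hB
  have hBb : #B ≤ b := hb B (by simp [hB]) (by
    rw [Finset.disjoint_left]; intro x hx; exact (Finset.mem_filter.1 hx).2.2)
  have hcover : (univ : Finset E) ⊆ (A ∪ ({x : E | x ∈ V ⊔ C} : Finset E)) ∪
      (({x : E | x ∈ C} : Finset E) ×ˢ B).image (fun p => p.2 - p.1) := by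
    intro x _
    by_cases hxW : x ∈ V ⊔ C
    · simp [hxW]
    by_cases hxA : ∀ c ∈ C, x + c ∈ M
    · exact Finset.mem_union_left _ (Finset.mem_union_left _ (by
        rw [hA, Finset.mem_filter]
        exact ⟨Finset.mem_univ x, hxW, hxA⟩))
    push Not at hxA
    obtain ⟨c, hc, hxc⟩ := hxA
    refine Finset.mem_union_right _ (Finset.mem_image.2 ⟨(c, x + c), ?_, by simp⟩)
    have : x + c ∉ V ⊔ C := fun h => hxW (by
      simpa using Submodule.sub_mem _ h (Submodule.mem_sup_right hc : _ ∈ V ⊔ C))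
    simp [hB, hc, hxc, this]
  have hcountA : 2 ^ finrank (ZMod 2) E ≤ #A + (2 ^ (finrank (ZMod 2) V + finrank (ZMod 2) C) +
      2 ^ finrank (ZMod 2) C * b) := by
    have h1 := Finset.card_le_card hcover
    rw [Finset.card_univ, hEcard] at h1
    refine h1.trans ((Finset.card_union_le _ _).trans ?_)
    rw [← add_assoc]
    refine add_le_add ((Finset.card_union_le _ _).trans ?_) (Finset.card_image_le.trans ?_)
    · rw [hcard, hsup]
    · rw [Finset.card_product, hcard]
      gcongr
  obtain ⟨U, hUV, a, hU, ha⟩ := exists_translate_subset_of_le V r t A (by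
    have := Nat.mul_le_mul_right (2 ^ t) hcountA
    rw [add_mul] at this
    omega) hr
  have haA : a ∈ A := by simpa using ha 0 U.zero_mem
  have haW : a ∉ V ⊔ C := (Finset.mem_filter.1 haA).2.1
  have ha0 : a ≠ 0 := fun h => haW (h ▸ Submodule.zero_mem _)
  refine ⟨U, C ⊔ Submodule.span (ZMod 2) {a}, ?_, hU, ?_, ?_⟩
  · rw [Submodule.disjoint_def]
    intro x hxU hx
    obtain ⟨w, hw, y, hy, rfl⟩ := Submodule.mem_sup.1 hx
    obtain ⟨c, rfl⟩ := Submodule.mem_span_singleton.1 hy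
    rcases hscal c with rfl | rfl
    · rw [zero_smul, add_zero] at hxU ⊢
      exact Submodule.disjoint_def.1 hVC w (hUV hxU) hw
    · rw [one_smul] at hxU
      refine absurd ?_ haW
      have := Submodule.sub_mem _ (Submodule.mem_sup_left (hUV hxU) : _ ∈ V ⊔ C)
        (Submodule.mem_sup_right hw)
      simpa using this
  · have hd : Disjoint C (Submodule.span (ZMod 2) {a}) :=
      (Submodule.disjoint_span_singleton' ha0).2 fun h => haW (Submodule.mem_sup_right h)
    have := Submodule.finrank_sup_add_finrank_inf_eq C (Submodule.span (ZMod 2) {a})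
    rwa [hd.eq_bot, finrank_bot, finrank_span_singleton ha0, add_zero] at this
  · intro v hv w hw hw0
    obtain ⟨w, hwC, y, hy, rfl⟩ := Submodule.mem_sup.1 hw
    obtain ⟨c, rfl⟩ := Submodule.mem_span_singleton.1 hy
    rcases hscal c with rfl | rfl
    · rw [zero_smul, add_zero] at hw0 ⊢
      exact hM v (hUV hv) w hwC hw0
    · have := (Finset.mem_filter.1 (ha v hv)).2.2 w hwC
      rw [one_smul]
      convert this using 1
      abel

theorem le_tower (i s : ℕ) : s ≤ tower i s := by
  induction i generalizing s with
  | zero => exact le_rfl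
  | succ i ih => exact (Nat.lt_two_pow_self).le.trans (ih _)

/-- A set of nonzero vectors of density at least `1 - 2^{-c} + ε` in a binary space of tower-type
dimension contains a copy of the geometry `G(m-1,2,c+1)`. -/
theorem exists_disjoint_submodules_of_dense (ε : ℝ) (hε0 : 0 < ε) (d : ℕ)
    (hd : 4 ≤ ε * 2 ^ (2 ^ d)) (n : ℕ) (M : Finset (Fin n → ZMod 2)) (h0 : 0 ∉ M) (c : ℕ) :
    ∀ m, c + 1 < m → tower (c + 1) (m + d) < n →
    (1 - ((2 : ℝ) ^ c)⁻¹ + ε) * ((2 : ℝ) ^ n - 1) ≤ #M →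
    ∃ V C : Submodule (ZMod 2) (Fin n → ZMod 2), Disjoint V C ∧
      finrank (ZMod 2) V = m - (c + 1) ∧ finrank (ZMod 2) C = c + 1 ∧
      ∀ v ∈ V, ∀ w ∈ C, w ≠ 0 → v + w ∈ M := by
  classical
  have hE : finrank (ZMod 2) (Fin n → ZMod 2) = n := by simp
  obtain ⟨e, he⟩ : ∃ e, 2 ^ d = e + 1 :=
    ⟨2 ^ d - 1, by have : 0 < 2 ^ d := by positivity
                   omega⟩
  have hd' : 2 ≤ ε * 2 ^ e := by rw [he, pow_succ] at hd; linarith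
  induction c with
  | zero =>
    intro m hm hn hM
    have hn' : 2 ^ (m + d) < n := hn
    have hn1 : (2 : ℝ) ≤ 2 ^ n := by
      calc (2 : ℝ) = 2 ^ 1 := by norm_num
        _ ≤ 2 ^ n := pow_le_pow_right₀ (by norm_num) (by omega)
    obtain ⟨U, a, hU, ha⟩ := exists_affine_subset (m - 1) e M (by
      rw [hE]
      have h1 : ((2 : ℝ) ^ n) ≤ #M * 2 ^ e := by
        have h2 : ε * (2 ^ n - 1) ≤ #M := by simpa using hM
        have h3 : (ε * (2 ^ n - 1)) * 2 ^ e ≤ #M * 2 ^ e := by gcongr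
        nlinarith
      exact_mod_cast h1) (by
      rw [hE, ← he]
      have h1 : 2 ^ (m + d) = 2 ^ (m - 1) * 2 ^ d + 2 ^ (m - 1) * 2 ^ d := by
        rw [← two_mul, ← pow_add, ← pow_succ']; congr 1; omega
      have h2 : m - 1 < 2 ^ (m - 1) := Nat.lt_two_pow_self
      have h3 : 2 ^ (m - 1) ≤ 2 ^ (m - 1) * 2 ^ d := Nat.le_mul_of_pos_right _ (by positivity)
      omega)
    have haU : a ∉ U := fun h => h0 (by simpa using ha (-a) (U.neg_mem h))
    have ha0 : a ≠ 0 := fun h => haU (h ▸ U.zero_mem)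
    refine ⟨U, Submodule.span (ZMod 2) {a}, (Submodule.disjoint_span_singleton' ha0).2 haU,
      hU, finrank_span_singleton ha0, ?_⟩
    intro v hv w hw hw0
    obtain ⟨x, rfl⟩ := Submodule.mem_span_singleton.1 hw
    have hscal : ∀ c : ZMod 2, c = 0 ∨ c = 1 := by decide
    rcases hscal x with rfl | rfl
    · simp at hw0
    · rw [one_smul, add_comm]
      exact ha v hv
  | succ c ih =>
    intro m hm hn hM
    have hmd : m + d < 2 ^ (m + d) := Nat.lt_two_pow_self
    obtain ⟨m', hm'⟩ : ∃ m', m' + d = 2 ^ (m + d) := ⟨2 ^ (m + d) - d, by omega⟩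
    have hn' : tower (c + 1) (m' + d) < n := by rw [hm']; exact hn
    have hn2 : 2 ^ (m' + d) < n := lt_of_le_of_lt (le_tower c _) hn'
    have hn1 : (1 : ℝ) ≤ 2 ^ n := one_le_pow₀ (by norm_num)
    obtain ⟨V, C, hVC, hV, hC, hVM⟩ := ih m' (by omega) hn' (by
      refine le_trans ?_ hM
      have : ((2 : ℝ) ^ (c + 1))⁻¹ ≤ (2 ^ c)⁻¹ := by
        gcongr <;> norm_num
      have h1 : (0 : ℝ) ≤ 2 ^ n - 1 := by linarith
      gcongr)
    obtain ⟨U, C', h1, h2, h3, h4⟩ := exists_extension M V C hVC hVM (m - (c + 2)) e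
      (2 ^ n - 1 - #M) (by
        intro B hB0 hBM
        have h1 : #(insert 0 (B ∪ M)) ≤ 2 ^ n := by
          refine (Finset.card_le_univ _).trans ?_
          simp
        rw [Finset.card_insert_of_notMem (by simp [hB0, h0]),
          Finset.card_union_of_disjoint hBM] at h1
        omega) (by
        rw [hE, hV, hC, Nat.sub_add_cancel (by omega)]
        have hMle : #M ≤ 2 ^ n - 1 := by
          have h1 : #(insert 0 M) ≤ 2 ^ n := (Finset.card_le_univ _).trans (by simp)
          rw [Finset.card_insert_of_notMem h0] at h1
          omega
        have hreal : (2 : ℝ) ^ n + (2 ^ m' + 2 ^ (c + 1) * (2 ^ n - 1 - #M)) * 2 ^ e ≤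
            2 ^ n * 2 ^ e := by
          have hP : (2 : ℝ) ≤ 2 ^ (c + 1) := by
            rw [pow_succ]; nlinarith [one_le_pow₀ (n := c) (show (1 : ℝ) ≤ 2 by norm_num)]
          have hbad : 2 ^ (c + 1) * ((2 : ℝ) ^ n - 1 - #M) ≤
              (1 - 2 * ε) * (2 ^ n - 1) := by
            have h1 : (2 : ℝ) ^ n - 1 - #M ≤ (((2 : ℝ) ^ (c + 1))⁻¹ - ε) * (2 ^ n - 1) := by
              linarith
            calc _ ≤ (2 : ℝ) ^ (c + 1) * ((((2 : ℝ) ^ (c + 1))⁻¹ - ε) * (2 ^ n - 1)) := by gcongr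
              _ = (1 - 2 ^ (c + 1) * ε) * (2 ^ n - 1) := by
                field_simp
              _ ≤ _ := by
                have : (0 : ℝ) ≤ 2 ^ n - 1 := by linarith
                gcongr
          have hexp : (2 : ℝ) ^ m' * 2 ^ e * 2 ≤ 2 ^ n := by
            rw [← pow_add, ← pow_succ]
            refine pow_le_pow_right₀ (by norm_num) ?_
            have h1 : m' < 2 ^ m' := Nat.lt_two_pow_self
            have h2 : (m' + 1) * 2 ^ d ≤ 2 ^ (m' + d) := by
              rw [pow_add]; exact Nat.mul_le_mul_right _ h1
            have h3 : m' ≤ m' * 2 ^ d := Nat.le_mul_of_pos_right _ (by positivity)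
            have h4 : (m' + 1) * 2 ^ d = m' * 2 ^ d + 2 ^ d := by ring
            omega
          have hm1 : (1 : ℝ) ≤ 2 ^ m' := one_le_pow₀ (by norm_num)
          have he0 : (0 : ℝ) < 2 ^ e := by positivity
          have hmul := mul_le_mul_of_nonneg_right hbad he0.le
          have h2n : (2 : ℝ) ≤ 2 ^ n := by
            calc (2 : ℝ) = 2 ^ 1 := by norm_num
              _ ≤ 2 ^ n := pow_le_pow_right₀ (by norm_num) (by omega)
          nlinarith [mul_le_mul_of_nonneg_right hd' (show (0 : ℝ) ≤ 2 ^ n - 1 by linarith)]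
        have hcast : (((2 ^ n - 1 - #M : ℕ)) : ℝ) = 2 ^ n - 1 - #M := by
          rw [Nat.cast_sub hMle, Nat.cast_sub Nat.one_le_two_pow]
          push_cast
          ring
        rw [← hcast] at hreal
        exact_mod_cast hreal) (by
        rw [hV, ← he]
        have h1 : 2 ^ (m - (c + 2)) * 2 ^ d ≤ 2 ^ (m + d - 1) := by
          rw [← pow_add]; exact Nat.pow_le_pow_right (by norm_num) (by omega)
        have h2 : 2 ^ (m + d) = 2 * 2 ^ (m + d - 1) := by
          rw [← pow_succ']; congr 1; omega
        have h3 : m + d - 1 < 2 ^ (m + d - 1) := Nat.lt_two_pow_self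
        omega)
    exact ⟨U, C', h1, h2, by rw [h3, hC], h4⟩

theorem finrank_stdSubspace (F : Type) [Field F] (m k : ℕ) (hk : k ≤ m) :
    finrank F (stdSubspace F m k) = k := by
  have h := LinearMap.finrank_range_add_finrank_ker
    (LinearMap.funLeft F F (fun i : {i : Fin m // k ≤ (i : ℕ)} => (i : Fin m)))
  rw [LinearMap.range_eq_top.2 (LinearMap.funLeft_surjective_of_injective F F _
    Subtype.val_injective), finrank_top, finrank_fintype_fun_eq_card, finrank_fintype_fun_eq_card,
    Fintype.card_fin] at h
  have hcard : Fintype.card {i : Fin m // k ≤ (i : ℕ)} = m - k := by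
    have h1 := Fintype.card_subtype_compl (fun i : Fin m => (i : ℕ) < k)
    have h2 : Fintype.card {i : Fin m // (i : ℕ) < k} = k := by
      rw [Fintype.card_congr (Fin.castLEquiv hk).symm]
      simp
    rw [h2, Fintype.card_fin] at h1
    rw [← h1]
    exact Fintype.card_congr (Equiv.subtypeEquivRight (by simp))
  rw [hcard] at h
  change _ + finrank F (stdSubspace F m k) = m at h
  omega

/-- `G(m-1,q,c)` is contained in any set of points that contains all points of `V ⊔ C`
outside `V`, for disjoint subspaces `V` and `C` of dimensions `m - c` and `c`. -/
theorem pgContains_pgDel_of_disjoint (F : Type) [Field F] (m n c : ℕ) (hc : c ≤ m)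
    (M : Set (Projectivization F (Fin n → F))) (V C : Submodule F (Fin n → F))
    (hVC : Disjoint V C) (hV : finrank F V = m - c) (hC : finrank F C = c)
    (hM : ∀ v ∈ V, ∀ w ∈ C, w ≠ 0 → ∃ h : v + w ≠ 0, Projectivization.mk F (v + w) h ∈ M) :
    PGContains F m n (pgDel F m c) M := by
  obtain ⟨D, hD⟩ := Submodule.exists_isCompl (stdSubspace F m (m - c))
  have hstd := finrank_stdSubspace F m (m - c) (Nat.sub_le _ _)
  have hDc : finrank F D = c := by
    have := Submodule.finrank_add_eq_of_isCompl hD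
    rw [hstd, finrank_fintype_fun_eq_card, Fintype.card_fin] at this
    omega
  let e₁ : stdSubspace F m (m - c) ≃ₗ[F] V := LinearEquiv.ofFinrankEq _ _ (by rw [hstd, hV])
  let e₂ : D ≃ₗ[F] C := LinearEquiv.ofFinrankEq _ _ (by rw [hDc, hC])
  let g := Submodule.prodEquivOfIsCompl _ _ hD
  let f : (Fin m → F) →ₗ[F] (Fin n → F) :=
    ((V.subtype ∘ₗ e₁.toLinearMap).coprod (C.subtype ∘ₗ e₂.toLinearMap)) ∘ₗ g.symm.toLinearMap
  have hfapp (p) : f (g p) = (e₁ p.1 : Fin n → F) + e₂ p.2 := by simp [f]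
  have hf : Function.Injective f := by
    rw [← LinearMap.ker_eq_bot, LinearMap.ker_eq_bot']
    intro x hx
    obtain ⟨p, rfl⟩ := g.surjective x
    rw [hfapp] at hx
    have h1 : (e₁ p.1 : Fin n → F) = 0 := by
      refine Submodule.disjoint_def.1 hVC _ (e₁ p.1).2 ?_
      rw [eq_neg_of_add_eq_zero_left hx]
      exact C.neg_mem (e₂ p.2).2
    rw [h1, zero_add] at hx
    have h2 : p.1 = 0 := by simpa using h1
    have h3 : p.2 = 0 := by simpa using hx
    rw [show p = 0 from Prod.ext h2 h3, map_zero]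
  refine ⟨f, hf, ?_⟩
  intro x hx
  induction x using Projectivization.ind with
  | h v hv =>
    obtain ⟨p, rfl⟩ := g.surjective v
    have hp : p.2 ≠ 0 := by
      intro h
      apply hx
      rw [Projectivization.submodule_mk, Submodule.span_singleton_le_iff_mem]
      simp [g, Submodule.coe_prodEquivOfIsCompl', h]
    obtain ⟨h0, hmem⟩ := hM _ (e₁ p.1).2 _ (e₂ p.2).2 (by simpa using hp)
    rw [Projectivization.map_mk]
    convert hmem using 2
    exact hfapp p

/-- Explicit binary bound: for `m > c ≥ 1` and `0 < ε ≤ 1`, with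
`d = ⌈log₂ ⌈2 - log₂ ε⌉⌉`, if `n > T_c(m + d)` then
`ex₂(G(m-1,2,c); n) < (1 - 2^(1-c) + ε)(2^n - 1)`. -/
theorem binary_tower_bound (m c : ℕ) (hc : 1 ≤ c) (hcm : c < m)
    (ε : ℝ) (hε0 : 0 < ε) (hε1 : ε ≤ 1)
    (d : ℤ) (hd : d = ⌈Real.logb 2 ((⌈2 - Real.logb 2 ε⌉ : ℤ) : ℝ)⌉)
    (n : ℕ) (hn : tower c (m + d.toNat) < n) :
    (pgEx (ZMod 2) m (pgDel (ZMod 2) m c) n : ℝ) <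
      (1 - (2 : ℝ) ^ (1 - (c : ℤ)) + ε) * ((2 : ℝ) ^ n - 1) := by
  classical
  have htwo : (1 : ℝ) < 2 := by norm_num
  have hceil : (2 : ℤ) ≤ ⌈2 - Real.logb 2 ε⌉ := by
    rw [Int.le_ceil_iff]
    have := Real.logb_nonpos htwo hε0.le hε1
    push_cast
    linarith
  have hpowd : 2 - Real.logb 2 ε ≤ 2 ^ d.toNat := by
    have hpos : (0 : ℝ) < (⌈2 - Real.logb 2 ε⌉ : ℤ) := by
      exact_mod_cast (show (0 : ℤ) < ⌈2 - Real.logb 2 ε⌉ by omega)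
    have h1 : Real.logb 2 ((⌈2 - Real.logb 2 ε⌉ : ℤ) : ℝ) ≤ (d.toNat : ℝ) := by
      refine (Int.le_ceil _).trans ?_
      rw [← hd]
      exact_mod_cast Int.self_le_toNat d
    rw [Real.logb_le_iff_le_rpow htwo hpos, Real.rpow_natCast] at h1
    exact (Int.le_ceil _).trans h1
  have hdε : 4 ≤ ε * 2 ^ (2 ^ d.toNat) := by
    have h1 : 2 ≤ Real.logb 2 ε + ((2 ^ d.toNat : ℕ) : ℝ) := by push_cast; linarith
    have h2 : (2 : ℝ) ^ (2 : ℝ) ≤ 2 ^ (Real.logb 2 ε + ((2 ^ d.toNat : ℕ) : ℝ)) :=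
      Real.rpow_le_rpow_of_exponent_le htwo.le h1
    rw [Real.rpow_add (by norm_num), Real.rpow_logb (by norm_num) (by norm_num) hε0,
      Real.rpow_natCast] at h2
    norm_num at h2 ⊢
    exact h2
  obtain ⟨c, rfl⟩ : ∃ c', c = c' + 1 := ⟨c - 1, by omega⟩
  have hexp : (2 : ℝ) ^ (1 - ((c + 1 : ℕ) : ℤ)) = (2 ^ c)⁻¹ := by
    rw [show (1 - ((c + 1 : ℕ) : ℤ)) = -(c : ℤ) by push_cast; ring, zpow_neg, zpow_natCast]
  rw [hexp]
  have hmain (k : ℕ) (hk : ∃ M : Set (Projectivization (ZMod 2) (Fin n → ZMod 2)),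
      ¬ PGContains (ZMod 2) m n (pgDel (ZMod 2) m (c + 1)) M ∧ M.ncard = k) :
      (k : ℝ) < (1 - ((2 : ℝ) ^ c)⁻¹ + ε) * ((2 : ℝ) ^ n - 1) := by
    obtain ⟨M, hM, rfl⟩ := hk
    by_contra! hcon
    apply hM
    let S : Finset (Fin n → ZMod 2) := {v | ∃ h : v ≠ 0, Projectivization.mk (ZMod 2) v h ∈ M}
    have hMS : M.ncard ≤ #S := by
      rw [← Set.ncard_coe_finset]
      refine Set.ncard_le_ncard_of_injOn Projectivization.rep ?_ ?_ S.finite_toSet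
      · intro x hx
        simp only [S, Finset.coe_filter, Finset.mem_univ, true_and, Set.mem_ofPred_eq]
        exact ⟨x.rep_nonzero, by rwa [Projectivization.mk_rep]⟩
      · intro x _ y _ hxy
        rw [← x.mk_rep, ← y.mk_rep]
        simp_rw [hxy]
    obtain ⟨V, C, hVC, hV, hC, hVM⟩ := exists_disjoint_submodules_of_dense ε hε0 d.toNat hdε n S
      (by simp [S]) c m hcm hn (hcon.trans (by exact_mod_cast hMS))
    refine pgContains_pgDel_of_disjoint (ZMod 2) m n (c + 1) hcm.le M V C hVC hV hC ?_
    intro v hv w hw hw0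
    simpa [S] using hVM v hv w hw hw0
  rcases Set.eq_empty_or_nonempty {k | ∃ M : Set (Projectivization (ZMod 2) (Fin n → ZMod 2)),
    ¬ PGContains (ZMod 2) m n (pgDel (ZMod 2) m (c + 1)) M ∧ M.ncard = k} with hS | hS
  · rw [pgEx, hS, csSup_empty]
    have h1 : ((2 : ℝ) ^ c)⁻¹ ≤ 1 := inv_le_one_of_one_le₀ (one_le_pow₀ htwo.le)
    have h2 : (1 : ℝ) < 2 ^ n := one_lt_pow₀ htwo (by omega)
    simp only [Nat.bot_eq_zero, Nat.cast_zero]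
    exact mul_pos (by linarith) (by linarith)
  · refine hmain _ (Nat.sSup_mem hS ⟨Nat.card (Projectivization (ZMod 2) (Fin n → ZMod 2)), ?_⟩)
    rintro k ⟨M, _, rfl⟩
    exact Set.ncard_le_card M
end
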